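/- arXiv:math/0301322 — 2 statements merged into one kernel-verified Lean document; each statement's English description precedes it below -/
import Mathlib

section
/- For every positive integer n and all complex numbers x, y, z with Re x > 0, Re y > 0 and Re z > -min(1/n, (Re x)/(n-1), (Re y)/(n-1)) (for n = 1 the condition is Re z > -1), one has ∫_{[0,1]^n} ∏_{j=1}^n t_j^{x-1} (1-t_j)^{y-1} ∏_{1≤j<k≤n} |t_j - t_k|^{2z} dt_1 ⋯ dt_n = ∏_{j=1}^n [Γ(x+(j-1)z) Γ(y+(j-1)z) Γ(jz+1)] / [Γ(x+y+(n+j-2)z) Γ(z+1)]. -/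
open MeasureTheory Complex

section

open Filter Topology ProbabilityTheory Set

theorem frequently_eq_of_eventually_ofReal {f g : ℂ → ℂ} {r : ℝ}
    (h : ∀ᶠ u : ℝ in 𝓝 r, f u = g u) : ∃ᶠ z in 𝓝[≠] (r : ℂ), f z = g z := by
  have ht : Tendsto (fun u : ℝ => (u : ℂ)) (𝓝[≠] r) (𝓝[≠] (r : ℂ)) :=
    tendsto_nhdsWithin_iff.2 ⟨(Complex.continuous_ofReal.tendsto r).mono_left nhdsWithin_le_nhds,
      eventually_nhdsWithin_of_forall fun u hu => by simpa using hu⟩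
  exact ht.frequently (h.filter_mono nhdsWithin_le_nhds).frequently

theorem complexMGF_eqOn_of_eventually_ofReal {Ω : Type*} [MeasurableSpace Ω] {ν : Measure Ω}
    {X : Ω → ℝ} {G : ℂ → ℂ} {I : Set ℝ} (hI : IsOpen I) (hIc : Convex ℝ I)
    (hG : DifferentiableOn ℂ G {s | s.re ∈ I})
    (hint : ∀ s ∈ I, Integrable (fun ω => Real.exp (s * X ω)) ν) {r : ℝ} (hr : r ∈ I)
    (heq : ∀ᶠ s : ℝ in 𝓝 r, complexMGF X ν s = G s) :
    EqOn (complexMGF X ν) G {s | s.re ∈ I} := by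
  have hopen : IsOpen {s : ℂ | s.re ∈ I} := hI.preimage Complex.continuous_re
  have hsub : I ⊆ interior (integrableExpSet X ν) := interior_maximal hint hI
  have hd : DifferentiableOn ℂ (complexMGF X ν) {s | s.re ∈ I} :=
    differentiableOn_complexMGF.mono fun s hs => hsub hs
  have hconv : Convex ℝ {s : ℂ | s.re ∈ I} := hIc.linear_preimage Complex.reLm
  exact (hd.analyticOnNhd hopen).eqOn_of_preconnected_of_frequently_eq (hG.analyticOnNhd hopen)
    hconv.isPreconnected (z₀ := (r : ℂ)) (by simpa using hr)
    (frequently_eq_of_eventually_ofReal heq)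

/-- A version of Landau's lemma for Laplace transforms of positive measures: the transform
converges on any half-plane to which it extends holomorphically. -/
theorem integrable_exp_mul_and_complexMGF_eq_of_continuation {Ω : Type*} [MeasurableSpace Ω]
    {ν : Measure Ω} {X : Ω → ℝ} (hX : AEMeasurable X ν) (hX0 : ∀ᵐ ω ∂ν, X ω ≤ 0) {α s₁ : ℝ}
    {G : ℂ → ℂ} (hG : DifferentiableOn ℂ G {s | α < s.re})
    (hint : ∀ s : ℝ, s₁ < s → Integrable (fun ω => Real.exp (s * X ω)) ν)
    (heq : ∀ s : ℝ, s₁ < s → complexMGF X ν s = G s) {s : ℝ} (hs : α < s) :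
    Integrable (fun ω => Real.exp (s * X ω)) ν ∧ complexMGF X ν s = G s := by
  rcases lt_or_ge s₁ s with h | hss
  · exact ⟨hint s h, heq s h⟩
  set r : ℝ := s₁ + 1 with hr
  have hEq : EqOn (complexMGF X ν) G {z : ℂ | z.re ∈ Ioi s₁} := by
    refine complexMGF_eqOn_of_eventually_ofReal isOpen_Ioi (convex_Ioi s₁)
      (hG.mono fun z hz => lt_of_lt_of_le hs (hss.trans (le_of_lt hz))) hint (r := r)
      (by simp [hr]) ?_
    filter_upwards [Ioi_mem_nhds (show s₁ < r by simp [hr])] with u hu using heq u hu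
  have hrint : r ∈ interior (integrableExpSet X ν) :=
    interior_maximal (s := integrableExpSet X ν) (t := Ioi s₁) (fun u hu => hint u hu)
      isOpen_Ioi (by simp [hr])
  have hder : ∀ n, iteratedDeriv n G r
      = ((∫ ω, X ω ^ n * Real.exp (r * X ω) ∂ν : ℝ) : ℂ) := by
    intro n
    have : complexMGF X ν =ᶠ[𝓝 (r : ℂ)] G := by
      refine hEq.eventuallyEq_of_mem ((isOpen_Ioi.preimage Complex.continuous_re).mem_nhds ?_)
      simp [hr]
    rw [← this.iteratedDeriv_eq, iteratedDeriv_complexMGF (by simpa using hrint),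
      ← integral_complex_ofReal]
    congr 1
    ext ω
    push_cast
    rfl
  have hsum := Complex.hasSum_taylorSeries_on_ball (f := G) (c := (r : ℂ)) (r := r - α)
    (z := (s : ℂ)) (hG.mono fun z hz => ?_) ?_
  rotate_left
  · have h1 : ‖z - r‖ < r - α := by simpa [dist_eq_norm] using hz
    have h2 := (abs_le.1 (Complex.abs_re_le_norm (z - r))).1
    simp only [sub_re, ofReal_re] at h2
    show α < z.re
    linarith
  · rw [Metric.mem_ball, Complex.dist_eq, ← Complex.ofReal_sub, Complex.norm_real, Real.norm_eq_abs,
      abs_lt]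
    constructor <;> linarith
  set F : ℕ → Ω → ℝ := fun n ω => ((n.factorial : ℝ)⁻¹ * ((s - r) * X ω) ^ n) * Real.exp (r * X ω)
    with hF
  have hterm : ∀ n, (n.factorial : ℂ)⁻¹ • ((s : ℂ) - r) ^ n • iteratedDeriv n G r
      = ((∫ ω, F n ω ∂ν : ℝ) : ℂ) := by
    intro n
    have : ∫ ω, F n ω ∂ν
        = ((n.factorial : ℝ)⁻¹ * (s - r) ^ n) * ∫ ω, X ω ^ n * Real.exp (r * X ω) ∂ν := by
      rw [← integral_const_mul]
      congr 1
      ext ω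
      simp only [hF, mul_pow]
      ring
    rw [this, hder, smul_eq_mul, smul_eq_mul]
    push_cast
    ring
  simp_rw [hterm] at hsum
  have hFint : ∀ n, Integrable (F n) ν := by
    intro n
    have := (integrable_pow_mul_exp_of_mem_interior_integrableExpSet hrint n).const_mul
      ((n.factorial : ℝ)⁻¹ * (s - r) ^ n)
    refine this.congr (.of_forall fun ω => ?_)
    simp only [hF, mul_pow]
    ring
  have hF0 : ∀ n, 0 ≤ᵐ[ν] F n := by
    intro n
    filter_upwards [hX0] with ω hω
    have : 0 ≤ (s - r) * X ω := mul_nonneg_of_nonpos_of_nonpos (by linarith) hω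
    simp only [hF, Pi.zero_apply]
    positivity
  have hsumre := Complex.hasSum_re hsum
  simp only [ofReal_re] at hsumre
  have hexp : ∀ ω, HasSum (fun n => F n ω) (Real.exp (s * X ω)) := by
    intro ω
    have h1 : HasSum (fun n : ℕ => (n.factorial : ℝ)⁻¹ * ((s - r) * X ω) ^ n)
        (Real.exp ((s - r) * X ω)) := by
      have := NormedSpace.expSeries_div_hasSum_exp ((s - r) * X ω)
      rw [← Real.exp_eq_exp_ℝ] at this
      simpa [div_eq_inv_mul] using this
    have h2 := h1.mul_right (Real.exp (r * X ω))
    rwa [← Real.exp_add, show (s - r) * X ω + r * X ω = s * X ω by ring] at h2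
  have hlint : ∫⁻ ω, ENNReal.ofReal (Real.exp (s * X ω)) ∂ν = ENNReal.ofReal (G s).re := by
    calc ∫⁻ ω, ENNReal.ofReal (Real.exp (s * X ω)) ∂ν
        = ∫⁻ ω, ∑' n, ENNReal.ofReal (F n ω) ∂ν := by
          refine lintegral_congr_ae ?_
          filter_upwards [ae_all_iff.2 hF0] with ω hω
          rw [← (hexp ω).tsum_eq, ENNReal.ofReal_tsum_of_nonneg (fun n => hω n) (hexp ω).summable]
      _ = ∑' n, ∫⁻ ω, ENNReal.ofReal (F n ω) ∂ν :=
          lintegral_tsum fun n => (hFint n).aemeasurable.ennreal_ofReal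
      _ = ∑' n, ENNReal.ofReal (∫ ω, F n ω ∂ν) := by
          congr 1
          ext n
          rw [ofReal_integral_eq_lintegral_ofReal (hFint n) (hF0 n)]
      _ = ENNReal.ofReal (G s).re := by
          rw [← hsumre.tsum_eq, ENNReal.ofReal_tsum_of_nonneg
            (fun n => integral_nonneg_of_ae (hF0 n)) hsumre.summable]
  have hmeas : AEStronglyMeasurable (fun ω => Real.exp (s * X ω)) ν :=
    (Real.measurable_exp.comp_aemeasurable (hX.const_mul s)).aestronglyMeasurable
  have hint' : Integrable (fun ω => Real.exp (s * X ω)) ν := by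
    refine ⟨hmeas, ?_⟩
    rw [hasFiniteIntegral_iff_ofReal (.of_forall fun ω => (Real.exp_pos _).le), hlint]
    exact ENNReal.ofReal_lt_top
  refine ⟨hint', ?_⟩
  have hFn : ∀ n, ∫ ω, ‖F n ω‖ ∂ν = ∫ ω, F n ω ∂ν := fun n =>
    integral_congr_ae ((hF0 n).mono fun ω hω => by simpa using abs_of_nonneg hω)
  have h3 := hasSum_integral_of_summable_integral_norm hFint
    (by simpa only [hFn] using hsumre.summable)
  simp only [(hexp _).tsum_eq] at h3
  rw [complexMGF_ofReal, mgf]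
  exact (Complex.hasSum_ofReal.2 h3).unique hsum

/-- The squared Vandermonde determinant of a tuple. -/
noncomputable def discSq {n : ℕ} (t : Fin n → ℝ) : ℝ := (Matrix.vandermonde t).det ^ 2

/-- The real Selberg density. -/
noncomputable def selbergWeight {n : ℕ} (a b c : ℝ) (t : Fin n → ℝ) : ℝ :=
  (∏ j, t j) ^ (a - 1) * (∏ j, (1 - t j)) ^ (b - 1) * discSq t ^ c

/-- Lebesgue measure on the unit cube. -/
noncomputable abbrev cubeMeasure (n : ℕ) : Measure (Fin n → ℝ) := volume.restrict (Icc 0 1)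

instance isFiniteMeasure_cubeMeasure (n : ℕ) : IsFiniteMeasure (cubeMeasure n) :=
  ⟨by rw [Measure.restrict_apply_univ]; exact isCompact_Icc.measure_lt_top⟩

theorem ae_cubeMeasure_mem (n : ℕ) : ∀ᵐ t ∂cubeMeasure n, t ∈ Icc (0 : Fin n → ℝ) 1 :=
  ae_restrict_mem measurableSet_Icc

theorem discSq_nonneg {n : ℕ} (t : Fin n → ℝ) : 0 ≤ discSq t := sq_nonneg _

theorem discSq_comp_perm {n : ℕ} (σ : Equiv.Perm (Fin n)) (t : Fin n → ℝ) :
    discSq (t ∘ σ) = discSq t := by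
  have h : Matrix.vandermonde (t ∘ σ) = (Matrix.vandermonde t).submatrix σ id := by
    ext i j
    simp [Matrix.vandermonde_apply]
  rw [discSq, discSq, h, Matrix.det_permute, mul_pow]
  rcases Int.units_eq_one_or (Equiv.Perm.sign σ) with h | h <;> simp [h]

theorem discSq_eq_zero {n : ℕ} {t : Fin n → ℝ} {i j : Fin n} (hij : i ≠ j) (h : t i = t j) :
    discSq t = 0 := by
  rw [discSq, Matrix.det_vandermonde_eq_zero_iff.2 ⟨i, j, h, hij⟩]
  simp

theorem discSq_cons {n : ℕ} (u : ℝ) (s : Fin n → ℝ) :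
    discSq (Fin.cons u s : Fin (n + 1) → ℝ) = (∏ j, (u - s j) ^ 2) * discSq s := by
  rw [discSq, discSq, Matrix.det_vandermonde, Matrix.det_vandermonde, Fin.prod_univ_succ, mul_pow,
    Fin.prod_Ioi_zero, ← Finset.prod_pow]
  congr 1
  · refine Finset.prod_congr rfl fun j _ => ?_
    simp only [Fin.cons_succ, Fin.cons_zero]
    ring
  · congr 1
    refine Finset.prod_congr rfl fun j _ => ?_
    rw [Fin.prod_Ioi_succ]
    simp

theorem measurable_discSq (n : ℕ) : Measurable (discSq : (Fin n → ℝ) → ℝ) := by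
  have : (discSq : (Fin n → ℝ) → ℝ) = fun t => (∏ i, ∏ j ∈ Finset.Ioi i, (t j - t i)) ^ 2 := by
    ext t
    rw [discSq, Matrix.det_vandermonde]
  rw [this]
  fun_prop

theorem measurable_selbergWeight (n : ℕ) (a b c : ℝ) :
    Measurable (selbergWeight a b c : (Fin n → ℝ) → ℝ) := by
  have := measurable_discSq n
  unfold selbergWeight
  fun_prop

theorem discSq_le_one {n : ℕ} {t : Fin n → ℝ} (ht : t ∈ Icc (0 : Fin n → ℝ) 1) :
    discSq t ≤ 1 := by
  rw [discSq, Matrix.det_vandermonde, ← sq_abs, Finset.abs_prod]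
  refine pow_le_one₀ (by positivity) (Finset.prod_le_one (fun _ _ => by positivity) fun i _ => ?_)
  rw [Finset.abs_prod]
  refine Finset.prod_le_one (fun _ _ => by positivity) fun j _ => ?_
  have h1 := ht.1 i; have h2 := ht.2 i; have h3 := ht.1 j; have h4 := ht.2 j
  simp only [Pi.zero_apply, Pi.one_apply] at h1 h2 h3 h4
  rw [abs_le]
  constructor <;> linarith

theorem discSq_le_sq_sub {n : ℕ} {t : Fin (n + 1) → ℝ} (ht : t ∈ Icc (0 : Fin (n + 1) → ℝ) 1)
    (j : Fin n) : discSq t ≤ (t 0 - t j.succ) ^ 2 := by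
  have htail : Fin.tail t ∈ Icc (0 : Fin n → ℝ) 1 := ⟨fun i => ht.1 i.succ, fun i => ht.2 i.succ⟩
  rw [← Fin.cons_self_tail t, discSq_cons, ← Finset.mul_prod_erase _ _ (Finset.mem_univ j)]
  simp only [Fin.cons_zero, Fin.cons_succ]
  have h1 : ∏ i ∈ Finset.univ.erase j, (t 0 - Fin.tail t i) ^ 2 ≤ 1 := by
    refine Finset.prod_le_one (fun _ _ => by positivity) fun i _ => ?_
    have h1 := ht.1 0; have h2 := ht.2 0; have h3 := htail.1 i; have h4 := htail.2 i
    simp only [Pi.zero_apply, Pi.one_apply] at h1 h2 h3 h4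
    rw [sq_le_one_iff_abs_le_one, abs_le]
    constructor <;> linarith
  have h0 : 0 ≤ ∏ i ∈ Finset.univ.erase j, (t 0 - Fin.tail t i) ^ 2 := by positivity
  rw [mul_assoc]
  exact mul_le_of_le_one_right (sq_nonneg _)
    (mul_le_one₀ h1 (discSq_nonneg _) (discSq_le_one htail))

theorem prod_mem_Icc_of_mem_cube {n : ℕ} {t : Fin n → ℝ} (ht : t ∈ Icc (0 : Fin n → ℝ) 1)
    (A : Finset (Fin n)) : ∏ j ∈ A, t j ∈ Icc (0 : ℝ) 1 :=
  ⟨Finset.prod_nonneg fun j _ => ht.1 j, Finset.prod_le_one (fun j _ => ht.1 j) fun j _ => ht.2 j⟩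

theorem prod_one_sub_mem_Icc_of_mem_cube {n : ℕ} {t : Fin n → ℝ}
    (ht : t ∈ Icc (0 : Fin n → ℝ) 1) : ∏ j, (1 - t j) ∈ Icc (0 : ℝ) 1 :=
  prod_mem_Icc_of_mem_cube (t := fun j => 1 - t j)
    ⟨fun j => sub_nonneg.2 (ht.2 j), fun j => sub_le_self _ (ht.1 j)⟩ _

theorem selbergWeight_nonneg {n : ℕ} (a b c : ℝ) {t : Fin n → ℝ}
    (ht : t ∈ Icc (0 : Fin n → ℝ) 1) : 0 ≤ selbergWeight a b c t := by
  have h1 := (prod_mem_Icc_of_mem_cube ht Finset.univ).1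
  have h2 := (prod_one_sub_mem_Icc_of_mem_cube ht).1
  have h3 := discSq_nonneg t
  unfold selbergWeight
  positivity

theorem selbergWeight_le_discSq_rpow {n : ℕ} {a b : ℝ} (ha : 1 ≤ a) (hb : 1 ≤ b) (c : ℝ)
    {t : Fin n → ℝ} (ht : t ∈ Icc (0 : Fin n → ℝ) 1) : selbergWeight a b c t ≤ discSq t ^ c := by
  have h1 := prod_mem_Icc_of_mem_cube ht Finset.univ
  have h2 := prod_one_sub_mem_Icc_of_mem_cube ht
  exact mul_le_of_le_one_left (Real.rpow_nonneg (discSq_nonneg t) _)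
    (mul_le_one₀ (Real.rpow_le_one h1.1 h1.2 (by linarith)) (Real.rpow_nonneg h2.1 _)
      (Real.rpow_le_one h2.1 h2.2 (by linarith)))

theorem selbergWeight_le_one {n : ℕ} {a b c : ℝ} (ha : 1 ≤ a) (hb : 1 ≤ b) (hc : 0 ≤ c)
    {t : Fin n → ℝ} (ht : t ∈ Icc (0 : Fin n → ℝ) 1) : selbergWeight a b c t ≤ 1 :=
  (selbergWeight_le_discSq_rpow ha hb c ht).trans
    (Real.rpow_le_one (discSq_nonneg t) (discSq_le_one ht) hc)

theorem selbergWeight_le_abs_sub {n : ℕ} {a b c : ℝ} (ha : 1 ≤ a) (hb : 1 ≤ b) (hc : 1 ≤ c)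
    {t : Fin (n + 1) → ℝ} (ht : t ∈ Icc (0 : Fin (n + 1) → ℝ) 1) (j : Fin n) :
    selbergWeight a b c t ≤ |t 0 - t j.succ| := by
  refine (selbergWeight_le_discSq_rpow ha hb c ht).trans ?_
  refine (Real.rpow_le_rpow_of_exponent_ge' (discSq_nonneg t) (discSq_le_one ht)
    (by norm_num : (0 : ℝ) ≤ 1 / 2) (by linarith)).trans ?_
  rw [← Real.sqrt_eq_rpow, ← Real.sqrt_sq_eq_abs]
  exact Real.sqrt_le_sqrt (discSq_le_sq_sub ht j)

theorem selbergWeight_comp_perm {n : ℕ} (a b c : ℝ) (σ : Equiv.Perm (Fin n)) (t : Fin n → ℝ) :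
    selbergWeight a b c (t ∘ σ) = selbergWeight a b c t := by
  simp only [selbergWeight, discSq_comp_perm, Function.comp_apply]
  rw [Equiv.prod_comp σ t, Equiv.prod_comp σ fun j => 1 - t j]

theorem integral_cube_comp_perm {n : ℕ} (σ : Equiv.Perm (Fin n)) (f : (Fin n → ℝ) → ℝ) :
    ∫ t, f (t ∘ σ) ∂cubeMeasure n = ∫ t, f t ∂cubeMeasure n := by
  have h := volume_measurePreserving_piCongrLeft (fun _ : Fin n => ℝ) σ.symm
  have he : ∀ t : Fin n → ℝ, MeasurableEquiv.piCongrLeft (fun _ : Fin n => ℝ) σ.symm t = t ∘ σ := by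
    intro t
    ext i
    have := MeasurableEquiv.piCongrLeft_apply_apply σ.symm (β := fun _ : Fin n => ℝ) t (σ i)
    simpa using this
  have h2 := h.setIntegral_preimage_emb (MeasurableEquiv.measurableEmbedding _) f (Icc 0 1)
  have hpre : (MeasurableEquiv.piCongrLeft (fun _ : Fin n => ℝ) σ.symm) ⁻¹' (Icc 0 1)
      = Icc 0 1 := by
    ext t
    simp only [mem_preimage, he, mem_Icc, Pi.le_def, Function.comp_apply, Pi.zero_apply,
      Pi.one_apply]
    rw [σ.forall_congr_right (q := fun i => 0 ≤ t i), σ.forall_congr_right (q := fun i => t i ≤ 1)]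
  rw [hpre] at h2
  simpa only [he] using h2

theorem integrable_cube_of_bounded {n : ℕ} {f : (Fin n → ℝ) → ℝ} (hf : Measurable f) (C : ℝ)
    (h : ∀ t ∈ Icc (0 : Fin n → ℝ) 1, |f t| ≤ C) : Integrable f (cubeMeasure n) := by
  refine Integrable.of_bound hf.aestronglyMeasurable C ?_
  filter_upwards [ae_cubeMeasure_mem n] with t ht using h t ht

theorem integrable_selbergWeight {n : ℕ} {a b c : ℝ} (ha : 1 ≤ a) (hb : 1 ≤ b) (hc : 0 ≤ c) :
    Integrable (selbergWeight a b c) (cubeMeasure n) := by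
  refine integrable_cube_of_bounded (measurable_selbergWeight n a b c) 1 fun t ht => ?_
  rw [abs_of_nonneg (selbergWeight_nonneg a b c ht)]
  exact selbergWeight_le_one ha hb hc ht

theorem integral_cube_succ {n : ℕ} {f : (Fin (n + 1) → ℝ) → ℝ}
    (hf : Integrable f (cubeMeasure (n + 1))) :
    ∫ t, f t ∂cubeMeasure (n + 1)
      = ∫ s, (∫ u in (0 : ℝ)..1, f (Fin.cons u s)) ∂cubeMeasure n := by
  have h := (volume_preserving_piFinSuccAbove (fun _ : Fin (n + 1) => ℝ) 0).symm
  have he : ∀ p : ℝ × (Fin n → ℝ),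
      (MeasurableEquiv.piFinSuccAbove (fun _ : Fin (n + 1) => ℝ) 0).symm p
        = (Fin.cons p.1 p.2 : Fin (n + 1) → ℝ) := by
    intro p
    simp [MeasurableEquiv.piFinSuccAbove, Fin.insertNthEquiv]
  have hpre : (MeasurableEquiv.piFinSuccAbove (fun _ : Fin (n + 1) => ℝ) 0).symm ⁻¹' (Icc 0 1)
      = Icc (0 : ℝ) 1 ×ˢ Icc (0 : Fin n → ℝ) 1 := by
    ext p
    simp only [mem_preimage, he, mem_Icc, Pi.le_def, mem_prod, Fin.forall_fin_succ, Fin.cons_zero,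
      Fin.cons_succ, Pi.zero_apply, Pi.one_apply]
    tauto
  have h2 := h.setIntegral_preimage_emb (MeasurableEquiv.measurableEmbedding _) f (Icc 0 1)
  have h3 := (h.integrableOn_comp_preimage (MeasurableEquiv.measurableEmbedding _)
    (f := f) (s := Icc 0 1)).2 hf
  rw [hpre] at h2 h3
  simp only [he] at h2
  have h4 : IntegrableOn (fun p : ℝ × (Fin n → ℝ) => f (Fin.cons p.1 p.2))
      (Icc (0 : ℝ) 1 ×ˢ Icc (0 : Fin n → ℝ) 1) (volume.prod volume) := by
    rw [← Measure.volume_eq_prod]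
    simpa only [Function.comp_def, he] using h3
  rw [cubeMeasure, ← h2]
  rw [IntegrableOn, ← Measure.prod_restrict] at h4
  rw [Measure.volume_eq_prod, ← Measure.prod_restrict, integral_prod_symm _ h4]
  congr 1
  ext s
  rw [intervalIntegral.integral_of_le zero_le_one, integral_Icc_eq_integral_Ioc]

theorem hasDerivAt_sq_sub_rpow {c : ℝ} (hc : 1 ≤ c) (v u : ℝ) :
    HasDerivAt (fun u : ℝ => ((u - v) ^ 2) ^ c) (c * ((u - v) ^ 2) ^ (c - 1) * (2 * (u - v))) u := by
  have h1 : HasDerivAt (fun u : ℝ => (u - v) ^ 2) (2 * (u - v)) u := by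
    simpa using ((hasDerivAt_id u).sub_const v).fun_pow 2
  convert! h1.rpow_const (p := c) (Or.inr hc) using 1
  ring

theorem integral_deriv_selberg_one_variable {n : ℕ} {p b c : ℝ} (hp : p = 0 ∨ 1 ≤ p) (hb : 1 ≤ b)
    (hc : 1 ≤ c) (s : Fin n → ℝ) :
    ∫ u in (0 : ℝ)..1, (p * u ^ (p - 1) * (1 - u) - b * u ^ p
        + ∑ j, 2 * c * (u ^ p * (1 - u) / (u - s j))) *
        ((1 - u) ^ (b - 1) * ∏ j, ((u - s j) ^ 2) ^ c)
      = -(0 ^ p * ∏ j, (s j ^ 2) ^ c) := by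
  have hp0 : 0 ≤ p := by rcases hp with h | h <;> linarith
  set D : ℝ → ℝ := fun u => ∏ j, ((u - s j) ^ 2) ^ c with hD
  set D' : ℝ → ℝ := fun u => ∑ j, (∏ i ∈ Finset.univ.erase j, ((u - s i) ^ 2) ^ c) *
    (c * ((u - s j) ^ 2) ^ (c - 1) * (2 * (u - s j))) with hD'
  have hDd : ∀ u, HasDerivAt D (D' u) u := by
    intro u
    have := HasDerivAt.fun_finsetProd (u := Finset.univ) (x := u)
      fun j _ => hasDerivAt_sq_sub_rpow hc (s j) u
    simpa only [smul_eq_mul] using this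
  have hcont : ∀ q : ℝ, 0 ≤ q → Continuous fun u : ℝ => u ^ q := fun q hq =>
    Real.continuous_rpow_const hq
  have hcont1 : ∀ q : ℝ, 0 ≤ q → Continuous fun u : ℝ => (1 - u) ^ q := fun q hq =>
    (Real.continuous_rpow_const hq).comp (by fun_prop)
  have hcont2 : ∀ q : ℝ, 0 ≤ q → ∀ v : ℝ, Continuous fun u : ℝ => ((u - v) ^ 2) ^ q := fun q hq v =>
    (Real.continuous_rpow_const hq).comp (by fun_prop)
  have hDc : Continuous D := continuous_finsetProd _ fun j _ => hcont2 c (by linarith) (s j)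
  have hD'c : Continuous D' := by
    refine continuous_finsetSum _ fun j _ => Continuous.mul
      (continuous_finsetProd _ fun i _ => hcont2 c (by linarith) (s i)) ?_
    have := hcont2 (c - 1) (by linarith) (s j)
    fun_prop
  have hpc : Continuous fun u : ℝ => p * u ^ (p - 1) := by
    rcases hp with rfl | h
    · simpa using continuous_const
    · exact continuous_const.mul (hcont _ (by linarith))
  set f : ℝ → ℝ := fun u => u ^ p * (1 - u) ^ b * D u with hf
  set f' : ℝ → ℝ := fun u => (p * u ^ (p - 1) * (1 - u) ^ b - u ^ p * (b * (1 - u) ^ (b - 1))) * D u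
    + u ^ p * (1 - u) ^ b * D' u with hf'
  have hfc : Continuous f := ((hcont p hp0).mul (hcont1 b (by linarith))).mul hDc
  have hf'c : Continuous f' := by
    have h1 := hcont p hp0
    have h2 := hcont1 b (by linarith)
    have h3 := hcont1 (b - 1) (by linarith)
    exact (((hpc.mul h2).sub (h1.mul (continuous_const.mul h3))).mul hDc).add ((h1.mul h2).mul hD'c)
  have hder : ∀ u ∈ Ioo (0 : ℝ) 1, HasDerivAt f (f' u) u := by
    intro u hu
    have h1 := Real.hasDerivAt_rpow_const (x := u) (p := p) (Or.inl hu.1.ne')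
    have h2 : HasDerivAt (fun u : ℝ => (1 - u) ^ b) (-(b * (1 - u) ^ (b - 1))) u := by
      have := ((hasDerivAt_id u).const_sub 1).rpow_const (p := b) (Or.inr hb)
      simpa using this
    convert! (h1.mul h2).mul (hDd u) using 1
    simp only [hf', Pi.mul_apply]
    ring
  have hftc := intervalIntegral.integral_eq_sub_of_hasDerivAt_of_le zero_le_one hfc.continuousOn
    hder (hf'c.intervalIntegrable 0 1)
  have hends : f 1 - f 0 = -(0 ^ p * ∏ j, (s j ^ 2) ^ c) := by
    simp [hf, hD, Real.zero_rpow (show b ≠ 0 by linarith)]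
  rw [← hends, ← hftc]
  refine intervalIntegral.integral_congr fun u hu => ?_
  rw [uIcc_of_le zero_le_one] at hu
  have hbb : (1 - u) ^ b = (1 - u) * (1 - u) ^ (b - 1) := by
    have := Real.rpow_add_one' (x := 1 - u) (y := b - 1) (by linarith [hu.2]) (by linarith)
    rw [show b - 1 + 1 = b by ring] at this
    rw [this, mul_comm]
  have hD'e : D' u = (∑ j, 2 * c / (u - s j)) * D u := by
    rw [hD', Finset.sum_mul]
    refine Finset.sum_congr rfl fun j _ => ?_
    rw [hD]
    simp only
    rw [← Finset.mul_prod_erase _ (fun j => ((u - s j) ^ 2) ^ c) (Finset.mem_univ j)]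
    rcases eq_or_ne (u - s j) 0 with h0 | h0
    · simp [h0]
    · have := Real.rpow_add_one' (x := (u - s j) ^ 2) (y := c - 1) (sq_nonneg _) (by linarith)
      rw [show c - 1 + 1 = c by ring] at this
      rw [this]
      field_simp
  simp only [hf', hD'e, hbb]
  have hs : ∑ j, 2 * c * (u ^ p * (1 - u) / (u - s j))
      = u ^ p * (1 - u) * ∑ j, 2 * c / (u - s j) := by
    rw [Finset.mul_sum]
    exact Finset.sum_congr rfl fun j _ => by ring
  rw [hs]
  ring

theorem discSq_cons_rpow {n : ℕ} (c u : ℝ) (s : Fin n → ℝ) :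
    discSq (Fin.cons u s : Fin (n + 1) → ℝ) ^ c = (∏ j, ((u - s j) ^ 2) ^ c) * discSq s ^ c := by
  rw [discSq_cons, Real.mul_rpow (by positivity) (discSq_nonneg s),
    Real.finsetProd_rpow _ _ fun _ _ => sq_nonneg _]

theorem selbergWeight_cons {n : ℕ} (a b c : ℝ) {u : ℝ} {s : Fin n → ℝ} (hu : u ∈ Icc (0 : ℝ) 1)
    (hs : s ∈ Icc (0 : Fin n → ℝ) 1) :
    selbergWeight a b c (Fin.cons u s : Fin (n + 1) → ℝ)
      = u ^ (a - 1) * ((1 - u) ^ (b - 1) * ∏ j, ((u - s j) ^ 2) ^ c) * selbergWeight a b c s := by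
  simp only [selbergWeight, Fin.prod_univ_succ (n := n), Fin.cons_zero, Fin.cons_succ,
    discSq_cons_rpow]
  rw [Real.mul_rpow hu.1 (prod_mem_Icc_of_mem_cube hs _).1,
    Real.mul_rpow (sub_nonneg.2 hu.2) (prod_one_sub_mem_Icc_of_mem_cube hs).1]
  ring

theorem integral_cube_eq_boundary {n : ℕ} {p b c : ℝ} (hp : p = 0 ∨ 1 ≤ p) (hb : 1 ≤ b)
    (hc : 1 ≤ c) {F : (Fin (n + 1) → ℝ) → ℝ} (hF : Integrable F (cubeMeasure (n + 1)))
    (R : (Fin n → ℝ) → ℝ)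
    (h : ∀ u ∈ Icc (0 : ℝ) 1, ∀ s ∈ Icc (0 : Fin n → ℝ) 1, F (Fin.cons u s) =
      (p * u ^ (p - 1) * (1 - u) - b * u ^ p + ∑ j, 2 * c * (u ^ p * (1 - u) / (u - s j))) *
        ((1 - u) ^ (b - 1) * ∏ j, ((u - s j) ^ 2) ^ c) * R s) :
    ∫ t, F t ∂cubeMeasure (n + 1)
      = ∫ s, -(0 ^ p * ∏ j, (s j ^ 2) ^ c) * R s ∂cubeMeasure n := by
  rw [integral_cube_succ hF]
  refine integral_congr_ae ?_
  filter_upwards [ae_cubeMeasure_mem n] with s hs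
  rw [← integral_deriv_selberg_one_variable hp hb hc s, ← intervalIntegral.integral_mul_const]
  refine intervalIntegral.integral_congr fun u hu => ?_
  rw [uIcc_of_le zero_le_one] at hu
  exact h u hu s hs

theorem integrable_div_sub_mul_selbergWeight {n : ℕ} {a b c : ℝ} (ha : 1 ≤ a) (hb : 1 ≤ b)
    (hc : 1 ≤ c) (j : Fin n) {g : (Fin (n + 1) → ℝ) → ℝ} (hg : Measurable g)
    (hg1 : ∀ t ∈ Icc (0 : Fin (n + 1) → ℝ) 1, |g t| ≤ 1) :
    Integrable (fun t => g t / (t 0 - t j.succ) * selbergWeight a b c t) (cubeMeasure (n + 1)) := by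
  refine integrable_cube_of_bounded ?_ 1 fun t ht => ?_
  · have := measurable_selbergWeight (n + 1) a b c
    fun_prop
  rw [abs_mul, abs_div, abs_of_nonneg (selbergWeight_nonneg a b c ht)]
  rcases eq_or_ne (t 0 - t j.succ) 0 with h0 | h0
  · simp [h0]
  calc |g t| / |t 0 - t j.succ| * selbergWeight a b c t
      ≤ 1 / |t 0 - t j.succ| * |t 0 - t j.succ| := by
        gcongr
        · exact selbergWeight_nonneg a b c ht
        · exact hg1 t ht
        · exact selbergWeight_le_abs_sub ha hb hc ht j
    _ = 1 := by field_simp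

theorem integral_div_sub_mul_selbergWeight {n : ℕ} {a b c : ℝ} (ha : 1 ≤ a) (hb : 1 ≤ b)
    (hc : 1 ≤ c) (j : Fin n) {g h : (Fin (n + 1) → ℝ) → ℝ} (hg : Measurable g)
    (hg1 : ∀ t ∈ Icc (0 : Fin (n + 1) → ℝ) 1, |g t| ≤ 1)
    (hgh : ∀ t, g t - g (t ∘ Equiv.swap 0 j.succ) = (t 0 - t j.succ) * h t) :
    2 * ∫ t, g t / (t 0 - t j.succ) * selbergWeight a b c t ∂cubeMeasure (n + 1)
      = ∫ t, h t * selbergWeight a b c t ∂cubeMeasure (n + 1) := by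
  set σ := Equiv.swap (0 : Fin (n + 1)) j.succ with hσ
  have hi := integrable_div_sub_mul_selbergWeight ha hb hc j hg hg1
  have hi2 : Integrable (fun t => g (t ∘ σ) / (t j.succ - t 0) * selbergWeight a b c t)
      (cubeMeasure (n + 1)) := by
    have hmeas : Measurable fun t : Fin (n + 1) → ℝ => g (t ∘ σ) :=
      hg.comp (measurable_pi_lambda _ fun i => measurable_pi_apply _)
    have := integrable_div_sub_mul_selbergWeight ha hb hc j (g := fun t => g (t ∘ σ)) hmeas
      fun t ht => hg1 _ ⟨fun i => ht.1 (σ i), fun i => ht.2 (σ i)⟩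
    refine this.neg.congr (.of_forall fun t => ?_)
    simp only [Pi.neg_apply]
    rw [← neg_sub (t 0), div_neg, neg_mul]
  have hperm := integral_cube_comp_perm σ
    fun t => g t / (t 0 - t j.succ) * selbergWeight a b c t
  simp only [selbergWeight_comp_perm, Function.comp_apply] at hperm
  rw [two_mul]
  nth_rewrite 1 [← hperm]
  simp only [hσ, Equiv.swap_apply_left, Equiv.swap_apply_right]
  rw [← hσ, ← integral_add hi2 hi]
  refine integral_congr_ae (.of_forall fun t => ?_)
  simp only
  rcases eq_or_ne (t 0 - t j.succ) 0 with h0 | h0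
  · have : selbergWeight a b c t = 0 := by
      rw [selbergWeight, discSq_eq_zero (Fin.succ_ne_zero j).symm (sub_eq_zero.1 h0),
        Real.zero_rpow (by linarith), mul_zero]
    simp [this]
  · rw [← neg_sub (t 0), div_neg, ← add_mul]
    congr 1
    field_simp
    linarith [hgh t]

theorem abs_le_one_of_mem_Icc {v : ℝ} (h : v ∈ Icc (0 : ℝ) 1) : |v| ≤ 1 := by
  rw [abs_of_nonneg h.1]
  exact h.2

theorem mul_mem_unitInterval {u v : ℝ} (hu : u ∈ Icc (0 : ℝ) 1) (hv : v ∈ Icc (0 : ℝ) 1) :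
    u * v ∈ Icc (0 : ℝ) 1 :=
  ⟨mul_nonneg hu.1 hv.1, mul_le_one₀ hu.2 hv.1 hv.2⟩

theorem one_sub_mem_unitInterval {u : ℝ} (hu : u ∈ Icc (0 : ℝ) 1) : 1 - u ∈ Icc (0 : ℝ) 1 :=
  ⟨sub_nonneg.2 hu.2, sub_le_self _ hu.1⟩

theorem integral_selbergWeight_one_succ {n : ℕ} {b c : ℝ} (hb : 1 ≤ b) (hc : 1 ≤ c) :
    ∫ t, selbergWeight (1 + 2 * c) b c t ∂cubeMeasure n
      = (b + c * n) * ∫ t, selbergWeight 1 b c t ∂cubeMeasure (n + 1) := by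
  have hw := integrable_selbergWeight (n := n + 1) le_rfl hb (by linarith : 0 ≤ c)
  have hgm : ∀ t ∈ Icc (0 : Fin (n + 1) → ℝ) 1, |1 - t 0| ≤ 1 := fun t ht =>
    abs_le_one_of_mem_Icc (one_sub_mem_unitInterval ⟨ht.1 0, ht.2 0⟩)
  have hi := fun j : Fin n => integrable_div_sub_mul_selbergWeight le_rfl hb hc j
    (g := fun t : Fin (n + 1) → ℝ => 1 - t 0) (by fun_prop) hgm
  have hval := fun j : Fin n => integral_div_sub_mul_selbergWeight le_rfl hb hc j
    (g := fun t : Fin (n + 1) → ℝ => 1 - t 0) (h := fun _ => -1) (by fun_prop) hgm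
    (fun t => by simp)
  simp only [neg_mul, one_mul, integral_neg] at hval
  set F : (Fin (n + 1) → ℝ) → ℝ := fun t => -b * selbergWeight 1 b c t
    + ∑ j : Fin n, 2 * c * ((1 - t 0) / (t 0 - t j.succ) * selbergWeight 1 b c t) with hF
  have hsi : Integrable (fun t : Fin (n + 1) → ℝ =>
      ∑ j : Fin n, 2 * c * ((1 - t 0) / (t 0 - t j.succ) * selbergWeight 1 b c t))
      (cubeMeasure (n + 1)) := integrable_finsetSum _ fun j _ => (hi j).const_mul _
  have hFi : Integrable F (cubeMeasure (n + 1)) := (hw.const_mul _).add hsi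
  have hF1 : ∫ t, F t ∂cubeMeasure (n + 1)
      = -(b + c * n) * ∫ t, selbergWeight 1 b c t ∂cubeMeasure (n + 1) := by
    rw [hF, integral_add (hw.const_mul _) hsi, integral_const_mul,
      integral_finsetSum _ fun j _ => (hi j).const_mul _]
    have : ∀ j : Fin n, ∫ t : Fin (n + 1) → ℝ,
        2 * c * ((1 - t 0) / (t 0 - t j.succ) * selbergWeight 1 b c t) ∂cubeMeasure (n + 1)
        = -c * ∫ t, selbergWeight 1 b c t ∂cubeMeasure (n + 1) := by
      intro j
      rw [integral_const_mul]
      linear_combination c * hval j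
    rw [Finset.sum_congr rfl fun j _ => this j]
    simp only [Finset.sum_const, Finset.card_univ, Fintype.card_fin, nsmul_eq_mul]
    ring
  have hF2 := integral_cube_eq_boundary (p := 0) (Or.inl rfl) hb hc hFi (selbergWeight 1 b c) ?_
  · rw [hF1] at hF2
    have hint : ∀ᵐ s ∂cubeMeasure n,
        -(0 ^ (0 : ℝ) * ∏ j, (s j ^ 2) ^ c) * selbergWeight 1 b c s
          = -selbergWeight (1 + 2 * c) b c s := by
      filter_upwards [ae_cubeMeasure_mem n] with s hs
      have h1 : (∏ j, s j) ^ (2 * c) = ∏ j, (s j ^ 2) ^ c := by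
        rw [Real.finsetProd_rpow _ _ fun _ _ => sq_nonneg _, Finset.prod_pow,
          ← Real.rpow_natCast_mul (prod_mem_Icc_of_mem_cube hs _).1]
        norm_num
      simp only [selbergWeight, add_sub_cancel_left, sub_self, Real.rpow_zero, h1]
      ring
    rw [integral_congr_ae hint, integral_neg] at hF2
    linarith
  · intro u hu s hs
    simp only [hF, selbergWeight_cons _ _ _ hu hs, Fin.cons_zero, Fin.cons_succ, sub_self,
      Real.rpow_zero, zero_mul, one_mul, mul_one, zero_sub, add_mul, Finset.sum_mul, mul_assoc]

/-- The integral of a squarefree monomial against the Selberg density. -/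
noncomputable def selbergMoment {n : ℕ} (a b c : ℝ) (A : Finset (Fin n)) : ℝ :=
  ∫ t, (∏ i ∈ A, t i) * selbergWeight a b c t ∂cubeMeasure n

theorem selbergMoment_map {n : ℕ} (a b c : ℝ) (σ : Equiv.Perm (Fin n)) (A : Finset (Fin n)) :
    selbergMoment a b c (A.map σ.toEmbedding) = selbergMoment a b c A := by
  rw [selbergMoment, selbergMoment,
    ← integral_cube_comp_perm σ fun t => (∏ i ∈ A, t i) * selbergWeight a b c t]
  simp [selbergWeight_comp_perm]

theorem integrable_prod_mul_selbergWeight {n : ℕ} {a b c : ℝ} (ha : 1 ≤ a) (hb : 1 ≤ b)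
    (hc : 0 ≤ c) (A : Finset (Fin n)) :
    Integrable (fun t => (∏ i ∈ A, t i) * selbergWeight a b c t) (cubeMeasure n) := by
  refine integrable_cube_of_bounded ?_ 1 fun t ht => ?_
  · have := measurable_selbergWeight n a b c
    fun_prop
  · exact abs_le_one_of_mem_Icc (mul_mem_unitInterval (prod_mem_Icc_of_mem_cube ht A)
      ⟨selbergWeight_nonneg a b c ht, selbergWeight_le_one ha hb hc ht⟩)

theorem selbergMoment_insert_succ {n : ℕ} (a b c : ℝ) {B : Finset (Fin n)} {j : Fin n}
    (hj : j ∉ B) : selbergMoment a b c (insert j.succ (B.map (Fin.succEmb n)))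
      = selbergMoment a b c (insert 0 (B.map (Fin.succEmb n))) := by
  rw [← selbergMoment_map a b c (Equiv.swap 0 j.succ)]
  congr 1
  rw [Finset.map_insert]
  congr 1
  · simp
  · ext i
    simp only [Finset.mem_map, exists_exists_and_eq_and,
      Fin.coe_succEmb, Equiv.coe_toEmbedding]
    refine exists_congr fun k => and_congr_right fun hk => ?_
    rw [Equiv.swap_apply_of_ne_of_ne (Fin.succ_ne_zero k)
      (fun h => hj (by rw [← Fin.succ_inj.1 h]; exact hk))]

/-- Aomoto's recursion between moments of consecutive degrees. -/
theorem selbergMoment_recursion {n : ℕ} {a b c : ℝ} (ha : 1 ≤ a) (hb : 1 ≤ b) (hc : 1 ≤ c)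
    (B : Finset (Fin n)) :
    (a + c * (n - B.card)) * selbergMoment a b c (B.map (Fin.succEmb n))
      = (a + b + c * (2 * n - B.card)) *
        selbergMoment a b c (insert 0 (B.map (Fin.succEmb n))) := by
  set P : (Fin (n + 1) → ℝ) → ℝ := fun t => ∏ i ∈ B, t i.succ with hP
  have hPm : Measurable P := by fun_prop
  have hc0 : 0 ≤ c := by linarith
  have hP0 : ∀ t : Fin (n + 1) → ℝ, ∏ i ∈ B.map (Fin.succEmb n), t i = P t := fun t => by
    simp [hP]
  have h0 : (0 : Fin (n + 1)) ∉ B.map (Fin.succEmb n) := by simp [Fin.succ_ne_zero]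
  have hP1 : ∀ t : Fin (n + 1) → ℝ,
      ∏ i ∈ insert 0 (B.map (Fin.succEmb n)), t i = t 0 * P t := fun t => by
    rw [Finset.prod_insert h0, hP0]
  have hA := integrable_prod_mul_selbergWeight ha hb hc0 (B.map (Fin.succEmb n))
  have hA0 := integrable_prod_mul_selbergWeight ha hb hc0 (insert 0 (B.map (Fin.succEmb n)))
  have hJA : selbergMoment a b c (B.map (Fin.succEmb n))
    = ∫ t, P t * selbergWeight a b c t ∂cubeMeasure (n + 1) := by simp only [selbergMoment, hP0]
  have hJA0 : selbergMoment a b c (insert 0 (B.map (Fin.succEmb n)))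
      = ∫ t, t 0 * P t * selbergWeight a b c t ∂cubeMeasure (n + 1) := by
    simp only [selbergMoment, hP1]
  set J := selbergMoment a b c (B.map (Fin.succEmb n)) with hJ
  set J0 := selbergMoment a b c (insert 0 (B.map (Fin.succEmb n))) with hJ0
  simp only [hP0] at hA
  simp only [hP1] at hA0
  have hPI : ∀ t ∈ Icc (0 : Fin (n + 1) → ℝ) 1, P t ∈ Icc (0 : ℝ) 1 := fun t ht => by
    rw [← hP0]
    exact prod_mem_Icc_of_mem_cube ht _
  set g : (Fin (n + 1) → ℝ) → ℝ := fun t => t 0 * (1 - t 0) * P t with hg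
  have hgm : Measurable g := by fun_prop
  have hg1 : ∀ t ∈ Icc (0 : Fin (n + 1) → ℝ) 1, |g t| ≤ 1 := fun t ht => by
    have ht0 : t 0 ∈ Icc (0 : ℝ) 1 := ⟨ht.1 0, ht.2 0⟩
    exact abs_le_one_of_mem_Icc (mul_mem_unitInterval
      (mul_mem_unitInterval ht0 (one_sub_mem_unitInterval ht0)) (hPI t ht))
  have hi := fun j : Fin n => integrable_div_sub_mul_selbergWeight ha hb hc j hgm hg1
  have hin : ∀ j ∈ B, 2 * ∫ t, g t / (t 0 - t j.succ) * selbergWeight a b c t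
      ∂cubeMeasure (n + 1) = -J0 := by
    intro j hj
    rw [integral_div_sub_mul_selbergWeight ha hb hc j (h := fun t => -(t 0 * P t)) hgm hg1, hJA0]
    · simp only [neg_mul, integral_neg]
    intro t
    have hprod : ∏ i ∈ B.erase j, t (Equiv.swap 0 j.succ i.succ) = ∏ i ∈ B.erase j, t i.succ := by
      refine Finset.prod_congr rfl fun i hi => ?_
      rw [Equiv.swap_apply_of_ne_of_ne (Fin.succ_ne_zero i)
        (fun h => Finset.ne_of_mem_erase hi (Fin.succ_injective _ h))]
    simp only [hg, hP, Function.comp_apply, Equiv.swap_apply_left]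
    rw [← Finset.mul_prod_erase _ _ hj, ← Finset.mul_prod_erase _ _ hj, hprod,
      Equiv.swap_apply_right]
    ring
  have hout : ∀ j ∉ B, 2 * ∫ t, g t / (t 0 - t j.succ) * selbergWeight a b c t
      ∂cubeMeasure (n + 1) = J - 2 * J0 := by
    intro j hj
    rw [integral_div_sub_mul_selbergWeight ha hb hc j (h := fun t => (1 - t 0 - t j.succ) * P t)
      hgm hg1]
    · have hj' : j.succ ∉ B.map (Fin.succEmb n) := by simpa using hj
      have hAj := integrable_prod_mul_selbergWeight ha hb hc0
        (insert j.succ (B.map (Fin.succEmb n)))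
      have hJj : J0 = ∫ t, t j.succ * P t * selbergWeight a b c t ∂cubeMeasure (n + 1) := by
        rw [hJ0, ← selbergMoment_insert_succ a b c hj]
        simp only [selbergMoment, Finset.prod_insert hj', hP0]
      simp only [Finset.prod_insert hj', hP0] at hAj
      have : ∀ t : Fin (n + 1) → ℝ, (1 - t 0 - t j.succ) * P t * selbergWeight a b c t
          = P t * selbergWeight a b c t - t 0 * P t * selbergWeight a b c t
            - t j.succ * P t * selbergWeight a b c t := fun t => by ring
      simp only [this]
      have hs1 : Integrable (fun t : Fin (n + 1) → ℝ => P t * selbergWeight a b c t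
        - t 0 * P t * selbergWeight a b c t) (cubeMeasure (n + 1)) := hA.sub hA0
      rw [integral_sub hs1 hAj, integral_sub hA hA0, ← hJA, ← hJA0, ← hJj]
      ring
    intro t
    have hprod : ∏ i ∈ B, t (Equiv.swap 0 j.succ i.succ) = ∏ i ∈ B, t i.succ := by
      refine Finset.prod_congr rfl fun i hi => ?_
      rw [Equiv.swap_apply_of_ne_of_ne (Fin.succ_ne_zero i)
        (fun h => hj (by rw [← Fin.succ_inj.1 h]; exact hi))]
    simp only [hg, hP, Function.comp_apply, Equiv.swap_apply_left, hprod]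
    ring
  set F : (Fin (n + 1) → ℝ) → ℝ := fun t => (a * (P t * selbergWeight a b c t)
      - (a + b) * (t 0 * P t * selbergWeight a b c t))
    + ∑ j : Fin n, 2 * c * (g t / (t 0 - t j.succ) * selbergWeight a b c t) with hF
  have hsi : Integrable (fun t : Fin (n + 1) → ℝ =>
      ∑ j : Fin n, 2 * c * (g t / (t 0 - t j.succ) * selbergWeight a b c t))
      (cubeMeasure (n + 1)) := integrable_finsetSum _ fun j _ => (hi j).const_mul _
  have hdi : Integrable (fun t : Fin (n + 1) → ℝ => a * (P t * selbergWeight a b c t)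
      - (a + b) * (t 0 * P t * selbergWeight a b c t)) (cubeMeasure (n + 1)) :=
    (hA.const_mul a).sub (hA0.const_mul (a + b))
  have hFi : Integrable F (cubeMeasure (n + 1)) := hdi.add hsi
  have hF1 : ∫ t, F t ∂cubeMeasure (n + 1)
      = a * J - (a + b) * J0 + c * (B.card * (-J0) + (n - B.card) * (J - 2 * J0)) := by
    rw [hF, integral_add hdi hsi, integral_sub (hA.const_mul a) (hA0.const_mul (a + b)),
      integral_const_mul, integral_const_mul, ← hJA, ← hJA0,
      integral_finsetSum _ fun j _ => (hi j).const_mul _]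
    congr 1
    have : ∀ j : Fin n, ∫ t : Fin (n + 1) → ℝ,
        2 * c * (g t / (t 0 - t j.succ) * selbergWeight a b c t) ∂cubeMeasure (n + 1)
        = c * if j ∈ B then -J0 else J - 2 * J0 := by
      intro j
      rw [integral_const_mul]
      split_ifs with hj
      · linear_combination c * hin j hj
      · linear_combination c * hout j hj
    rw [Finset.sum_congr rfl fun j _ => this j, ← Finset.mul_sum, Finset.sum_ite]
    congr 1
    have hcard : (((Finset.univ.filter fun j => j ∉ B).card : ℕ) : ℝ) = n - B.card := by
      rw [show (Finset.univ.filter fun j => j ∉ B) = Bᶜ by ext; simp, Finset.card_compl,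
        Fintype.card_fin, Nat.cast_sub (by simpa using Finset.card_le_univ B)]
    simp only [Finset.sum_const, nsmul_eq_mul, hcard]
    simp
  have hF2 := integral_cube_eq_boundary (p := a) (Or.inr ha) hb hc hFi
    (fun s => (∏ i ∈ B, s i) * selbergWeight a b c s) ?_
  · rw [hF1, Real.zero_rpow (by linarith)] at hF2
    simp only [zero_mul, neg_zero, integral_zero] at hF2
    linear_combination hF2
  · intro u hu s hs
    have hua : u ^ a = u ^ (a - 1) * u := by
      have := Real.rpow_add_one' (x := u) (y := a - 1) hu.1 (by linarith)
      rwa [show a - 1 + 1 = a by ring] at this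
    have hsum : ∑ j, 2 * c * (u ^ a * (1 - u) / (u - s j))
        = u ^ (a - 1) * (u * (1 - u)) * (2 * c) * ∑ j, (u - s j)⁻¹ := by
      rw [hua, Finset.mul_sum]
      exact Finset.sum_congr rfl fun j _ => by ring
    have hsum2 : ∀ x y : ℝ, ∑ j, 2 * c * (x / (u - s j) * y)
        = 2 * c * x * y * ∑ j, (u - s j)⁻¹ := fun x y => by
      rw [Finset.mul_sum]
      exact Finset.sum_congr rfl fun j _ => by ring
    simp only [hF, hg, hP, selbergWeight_cons _ _ _ hu hs, Fin.cons_zero, Fin.cons_succ, hsum,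
      hsum2]
    rw [hua]
    ring

theorem selbergMoment_eq_prod {n : ℕ} {a b c : ℝ} (ha : 1 ≤ a) (hb : 1 ≤ b) (hc : 1 ≤ c) (k : ℕ)
    (A : Finset (Fin (n + 1))) (hA : A.card = k) :
    selbergMoment a b c A = (∏ l ∈ Finset.range k,
      (a + c * (n - l)) / (a + b + c * (2 * n - l))) *
        ∫ t, selbergWeight a b c t ∂cubeMeasure (n + 1) := by
  induction k generalizing A with
  | zero =>
    rw [Finset.card_eq_zero.1 hA]
    simp [selbergMoment]
  | succ k ih =>
    obtain ⟨i, hi⟩ : A.Nonempty := Finset.card_pos.1 (by omega)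
    set A' := A.map (Equiv.swap 0 i).toEmbedding with hA'
    have h0 : 0 ∈ A' := by
      rw [hA', Finset.mem_map]
      exact ⟨i, hi, by simp⟩
    set B : Finset (Fin n) := Finset.univ.filter fun j => j.succ ∈ A' with hB
    have hAB : A' = insert 0 (B.map (Fin.succEmb n)) := by
      ext m
      refine Fin.cases ?_ (fun j => ?_) m
      · simp [h0]
      · simp [hB, Fin.succ_ne_zero]
    have hBk : B.card = k := by
      have h1 : A'.card = k + 1 := by rw [hA', Finset.card_map, hA]
      rw [hAB, Finset.card_insert_of_notMem (by simp [Fin.succ_ne_zero]), Finset.card_map] at h1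
      omega
    have hkn : (k : ℝ) ≤ n := by
      have := Finset.card_le_univ B
      rw [hBk, Fintype.card_fin] at this
      exact_mod_cast this
    have hrec := selbergMoment_recursion ha hb hc B
    rw [← hAB, hA', selbergMoment_map, ih _ (by rw [Finset.card_map, hBk]), hBk] at hrec
    have hne : a + b + c * (2 * n - k) ≠ 0 := by
      have h1 : 0 ≤ c * (2 * n - k) := mul_nonneg (by linarith) (by
        have : (0 : ℝ) ≤ n := Nat.cast_nonneg n
        linarith)
      linarith
    rw [Finset.prod_range_succ]
    generalize (∏ l ∈ Finset.range k, (a + c * (n - l)) / (a + b + c * (2 * n - l))) = Q at hrec ⊢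
    refine mul_left_cancel₀ hne (hrec.symm.trans ?_)
    generalize a + b + c * (2 * (n : ℝ) - k) = d at hne ⊢
    field_simp

theorem integral_selbergWeight_add_one {n : ℕ} {a b c : ℝ} (ha : 1 ≤ a) (hb : 1 ≤ b)
    (hc : 1 ≤ c) :
    ∫ t, selbergWeight (a + 1) b c t ∂cubeMeasure (n + 1) = (∏ l ∈ Finset.range (n + 1),
      (a + c * (n - l)) / (a + b + c * (2 * n - l))) *
        ∫ t, selbergWeight a b c t ∂cubeMeasure (n + 1) := by
  rw [← selbergMoment_eq_prod ha hb hc (n + 1) Finset.univ (by simp), selbergMoment]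
  refine integral_congr_ae ?_
  filter_upwards [ae_cubeMeasure_mem (n + 1)] with t ht
  have := Real.rpow_add_one' (x := ∏ j, t j) (y := a - 1)
    (prod_mem_Icc_of_mem_cube ht _).1 (by linarith)
  rw [show a - 1 + 1 = a by ring] at this
  rw [selbergWeight, selbergWeight, add_sub_cancel_right, this]
  ring

/-- The product of Gamma values in Selberg's formula, for real parameters. -/
noncomputable def selbergGamma (n : ℕ) (a b c : ℝ) : ℝ :=
  ∏ j ∈ Finset.range n, Real.Gamma (a + j * c) * Real.Gamma (b + j * c) *
    Real.Gamma ((j + 1) * c + 1) / (Real.Gamma (a + b + (n + j - 1) * c) * Real.Gamma (c + 1))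

theorem selbergGamma_pos {n : ℕ} {a b c : ℝ} (ha : 0 < a) (hb : 0 < b) (hc : 0 ≤ c) :
    0 < selbergGamma n a b c := by
  refine Finset.prod_pos fun j hj => ?_
  have hn : (1 : ℝ) ≤ n := by
    have := Finset.mem_range.1 hj
    exact_mod_cast (by omega : 1 ≤ n)
  have h1 : 0 < a + j * c := by positivity
  have h2 : 0 < b + j * c := by positivity
  have h3 : 0 < (j + 1) * c + 1 := by positivity
  have h4 : 0 < a + b + (n + j - 1) * c := by
    have : 0 ≤ (n + j - 1) * c := mul_nonneg (by
      have : (0 : ℝ) ≤ j := Nat.cast_nonneg j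
      linarith) hc
    linarith
  have h5 : 0 < c + 1 := by positivity
  have := Real.Gamma_pos_of_pos h1
  have := Real.Gamma_pos_of_pos h2
  have := Real.Gamma_pos_of_pos h3
  have := Real.Gamma_pos_of_pos h4
  have := Real.Gamma_pos_of_pos h5
  positivity

theorem selbergGamma_add_one {n : ℕ} {a b c : ℝ} (ha : 0 < a) (hb : 0 < b) (hc : 0 ≤ c) :
    selbergGamma (n + 1) (a + 1) b c = (∏ l ∈ Finset.range (n + 1),
      (a + c * (n - l)) / (a + b + c * (2 * n - l))) * selbergGamma (n + 1) a b c := by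
  rw [← Finset.prod_range_reflect, selbergGamma, selbergGamma, ← Finset.prod_mul_distrib]
  refine Finset.prod_congr rfl fun j hj => ?_
  have hjn : j ≤ n := by
    have := Finset.mem_range.1 hj
    omega
  have h1 : 0 < a + j * c := by positivity
  have h4 : 0 < a + b + (n + j) * c := by positivity
  have e1 : ((n + 1 - 1 - j : ℕ) : ℝ) = n - j := by
    rw [Nat.add_sub_cancel, Nat.cast_sub hjn]
  have e2 : a + 1 + j * c = a + j * c + 1 := by ring
  have e3 : a + 1 + b + (((n + 1 : ℕ) : ℝ) + j - 1) * c = a + b + (n + j) * c + 1 := by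
    push_cast
    ring
  have e4 : a + b + (((n + 1 : ℕ) : ℝ) + j - 1) * c = a + b + (n + j) * c := by
    push_cast
    ring
  have e5 : a + c * ((n : ℝ) - (n - j)) = a + j * c := by ring
  have e6 : a + b + c * (2 * (n : ℝ) - (n - j)) = a + b + (n + j) * c := by ring
  rw [e1, e2, e3, e4, e5, e6, Real.Gamma_add_one h1.ne', Real.Gamma_add_one h4.ne']
  have := Real.Gamma_pos_of_pos h4
  have := Real.Gamma_pos_of_pos (show 0 < c + 1 by positivity)
  field_simp

theorem selbergGamma_one_succ {n : ℕ} {b c : ℝ} (hb : 0 < b) (hc : 0 ≤ c) :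
    selbergGamma n (1 + 2 * c) b c = (b + c * n) * selbergGamma (n + 1) 1 b c := by
  set f : ℕ → ℝ := fun j => Real.Gamma (1 + j * c) with hf
  set g : ℕ → ℝ := fun j => Real.Gamma (b + j * c) with hg
  set h : ℕ → ℝ := fun j => Real.Gamma (1 + b + (n + j) * c) with hh
  have hfpos : ∀ j, 0 < f j := fun j => Real.Gamma_pos_of_pos (by positivity)
  have hhpos : ∀ j, 0 < h j := fun j => Real.Gamma_pos_of_pos (by positivity)
  have hL : selbergGamma n (1 + 2 * c) b c
      = ∏ j ∈ Finset.range n, f (j + 2) * g j * f (j + 1) / (h (j + 1) * f 1) := by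
    refine Finset.prod_congr rfl fun j _ => ?_
    simp only [hf, hg, hh]
    rw [show 1 + 2 * c + j * c = 1 + ((j + 2 : ℕ) : ℝ) * c by push_cast; ring,
      show (j + 1) * c + 1 = 1 + ((j + 1 : ℕ) : ℝ) * c by push_cast; ring,
      show 1 + 2 * c + b + (n + j - 1) * c = 1 + b + (n + ((j + 1 : ℕ) : ℝ)) * c by
        push_cast; ring,
      show c + 1 = 1 + ((1 : ℕ) : ℝ) * c by push_cast; ring]
  have hR : selbergGamma (n + 1) 1 b c
      = ∏ j ∈ Finset.range (n + 1), f j * g j * f (j + 1) / (h j * f 1) := by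
    refine Finset.prod_congr rfl fun j _ => ?_
    simp only [hf, hg, hh]
    rw [show (j + 1) * c + 1 = 1 + ((j + 1 : ℕ) : ℝ) * c by push_cast; ring,
      show 1 + b + (((n + 1 : ℕ) : ℝ) + j - 1) * c = 1 + b + (n + j) * c by push_cast; ring,
      show c + 1 = 1 + ((1 : ℕ) : ℝ) * c by push_cast; ring]
  have hfp : (∏ j ∈ Finset.range n, f (j + 2)) * f 1 * f 0
      = (∏ j ∈ Finset.range (n + 1), f j) * f (n + 1) := by
    rw [← Finset.prod_range_succ, Finset.prod_range_succ', Finset.prod_range_succ']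
  have hhp : (∏ j ∈ Finset.range n, h (j + 1)) * h 0 = ∏ j ∈ Finset.range (n + 1), h j := by
    rw [Finset.prod_range_succ']
  have hgh : h 0 = (b + c * n) * g n := by
    simp only [hh, hg]
    rw [show 1 + b + (n + ((0 : ℕ) : ℝ)) * c = (b + n * c) + 1 by push_cast; ring,
      Real.Gamma_add_one (by positivity)]
    ring
  have hf0 : f 0 = 1 := by simp [hf]
  rw [hL, hR]
  simp only [Finset.prod_div_distrib, Finset.prod_mul_distrib]
  rw [← hhp, hgh, Finset.prod_range_succ g, Finset.prod_range_succ (fun j => f (j + 1)),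
    Finset.prod_range_succ (fun _ => f 1)]
  rw [hf0, mul_one] at hfp
  have hg0 : 0 < g n := Real.Gamma_pos_of_pos (by positivity)
  have hbn : 0 < b + c * n := by positivity
  have hP : 0 < ∏ j ∈ Finset.range n, h (j + 1) := Finset.prod_pos fun j _ => hhpos _
  have hP1 : 0 < ∏ j ∈ Finset.range n, f 1 := Finset.prod_pos fun j _ => hfpos _
  have hf1 := hfpos 1
  field_simp
  linear_combination (∏ j ∈ Finset.range n, g j) * (∏ j ∈ Finset.range n, f (j + 1)) * hfp

theorem tendsto_Gamma_div_rpow_mul_factorial {s : ℝ} (hs : 0 < s) :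
    Tendsto (fun m : ℕ => Real.Gamma (s + m + 1) / ((m : ℝ) ^ s * m.factorial)) atTop (𝓝 1) := by
  have hG := Real.Gamma_pos_of_pos hs
  have h := (Real.GammaSeq_tendsto_Gamma s).inv₀ hG.ne' |>.const_mul (Real.Gamma s)
  rw [mul_inv_cancel₀ hG.ne'] at h
  refine h.congr fun m => ?_
  have hprod : ∀ k : ℕ, Real.Gamma (s + k) = (∏ j ∈ Finset.range k, (s + j)) * Real.Gamma s := by
    intro k
    induction k with
    | zero => simp
    | succ k ih =>
      rw [Finset.prod_range_succ, Nat.cast_succ, ← add_assoc, Real.Gamma_add_one (by positivity),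
        ih]
      ring
  have := hprod (m + 1)
  rw [Nat.cast_succ, ← add_assoc] at this
  rw [this, Real.GammaSeq, inv_div]
  ring

theorem tendsto_Gamma_div_Gamma {s q : ℝ} (hs : 0 < s) (hq : 0 ≤ q) :
    Tendsto (fun m : ℕ => Real.Gamma (s + m + 1) / Real.Gamma (s + q + m + 1) * (m : ℝ) ^ q) atTop
      (𝓝 1) := by
  have h := (tendsto_Gamma_div_rpow_mul_factorial hs).div
    (tendsto_Gamma_div_rpow_mul_factorial (show 0 < s + q by linarith)) one_ne_zero
  rw [div_one] at h
  refine h.congr' ?_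
  filter_upwards [eventually_gt_atTop 0] with m hm
  have hm' : (0 : ℝ) < m := by exact_mod_cast hm
  have h1 : 0 < Real.Gamma (s + q + m + 1) := Real.Gamma_pos_of_pos (by positivity)
  have h2 : (0 : ℝ) < m ^ s := by positivity
  have h3 : (0 : ℝ) < m ^ q := by positivity
  have h4 : (0 : ℝ) < m.factorial := by positivity
  simp only [Pi.div_apply]
  rw [Real.rpow_add hm']
  field_simp

theorem tendsto_selbergGamma_mul_rpow {n : ℕ} {b c : ℝ} (hb : 0 < b) (hc : 0 ≤ c) {a : ℝ}
    (ha : 0 < a) :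
    Tendsto (fun m : ℕ => selbergGamma (n + 1) (a + m + 1) b c * ((m : ℝ) ^ (b + n * c)) ^ (n + 1))
      atTop (𝓝 (∏ j ∈ Finset.range (n + 1), Real.Gamma (b + j * c) * Real.Gamma ((j + 1) * c + 1) /
        Real.Gamma (c + 1))) := by
  have h : Tendsto (fun m : ℕ => ∏ j ∈ Finset.range (n + 1),
      Real.Gamma (a + j * c + m + 1) / Real.Gamma (a + j * c + (b + n * c) + m + 1) *
        (m : ℝ) ^ (b + n * c) * (Real.Gamma (b + j * c) * Real.Gamma ((j + 1) * c + 1) /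
        Real.Gamma (c + 1))) atTop (𝓝 (∏ j ∈ Finset.range (n + 1),
        1 * (Real.Gamma (b + j * c) * Real.Gamma ((j + 1) * c + 1) / Real.Gamma (c + 1)))) :=
    tendsto_finsetProd _ fun j _ => (tendsto_Gamma_div_Gamma (by positivity)
      (by positivity)).mul_const _
  simp only [one_mul] at h
  refine h.congr fun m => ?_
  have : ((m : ℝ) ^ (b + n * c)) ^ (n + 1) = ∏ _j ∈ Finset.range (n + 1), (m : ℝ) ^ (b + n * c) := by
    simp
  rw [this, selbergGamma, ← Finset.prod_mul_distrib]
  refine Finset.prod_congr rfl fun j _ => ?_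
  have e1 : a + m + 1 + j * c = a + j * c + m + 1 := by ring
  have e2 : a + m + 1 + b + (((n + 1 : ℕ) : ℝ) + j - 1) * c
      = a + j * c + (b + n * c) + m + 1 := by
    push_cast
    ring
  rw [e1, e2]
  ring

theorem integral_selbergWeight_anti {n : ℕ} {a a' b c : ℝ} (ha : 1 ≤ a) (haa : a ≤ a')
    (hb : 1 ≤ b) (hc : 0 ≤ c) :
    ∫ t, selbergWeight a' b c t ∂cubeMeasure n ≤ ∫ t, selbergWeight a b c t ∂cubeMeasure n := by
  refine integral_mono_ae (integrable_selbergWeight (ha.trans haa) hb hc)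
    (integrable_selbergWeight ha hb hc) ?_
  filter_upwards [ae_cubeMeasure_mem n] with t ht
  have h1 := prod_mem_Icc_of_mem_cube ht Finset.univ
  have h2 := prod_one_sub_mem_Icc_of_mem_cube ht
  have h3 := discSq_nonneg t
  refine mul_le_mul_of_nonneg_right (mul_le_mul_of_nonneg_right ?_ (Real.rpow_nonneg h2.1 _))
    (Real.rpow_nonneg h3 _)
  exact Real.rpow_le_rpow_of_exponent_ge' h1.1 h1.2 (by linarith) (by linarith)

theorem integral_selbergWeight_of_one_le (n : ℕ) {a b c : ℝ} (ha : 1 ≤ a) (hb : 1 ≤ b)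
    (hc : 1 ≤ c) : ∫ t, selbergWeight a b c t ∂cubeMeasure n = selbergGamma n a b c := by
  induction n generalizing a with
  | zero =>
    have : ∀ t : Fin 0 → ℝ, selbergWeight a b c t = 1 := fun t => by simp [selbergWeight, discSq]
    simp only [this, selbergGamma]
    have h1 : Icc (0 : Fin 0 → ℝ) 1 = univ := by
      ext t
      simp
    rw [cubeMeasure, h1, Measure.restrict_univ, Measure.volume_pi_eq_dirac]
    simp
  | succ n ih =>
    have hb0 : 0 < b := by linarith
    have hc0 : 0 ≤ c := by linarith
    set S : ℝ → ℝ := fun a => ∫ t, selbergWeight a b c t ∂cubeMeasure (n + 1) with hS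
    set G : ℝ → ℝ := fun a => selbergGamma (n + 1) a b c with hG
    have hGpos : ∀ a, 1 ≤ a → 0 < G a := fun a ha => selbergGamma_pos (by linarith) hb0 hc0
    have hstep : ∀ a, 1 ≤ a → S (a + 1) * G a = S a * G (a + 1) := by
      intro a ha
      simp only [hS, hG]
      rw [integral_selbergWeight_add_one ha hb hc, selbergGamma_add_one (by linarith) hb0 hc0]
      ring
    have hadd : ∀ a, 1 ≤ a → ∀ m : ℕ, S (a + m) * G a = S a * G (a + m) := by
      intro a ha m
      induction m with
      | zero => simp
      | succ m ihm =>
        have hm : (0 : ℝ) ≤ m := Nat.cast_nonneg m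
        have h1 := hstep (a + m) (by linarith)
        rw [Nat.cast_succ, ← add_assoc]
        refine mul_right_cancel₀ (hGpos (a + m) (by linarith)).ne' ?_
        linear_combination G a * h1 + G (a + m + 1) * ihm
    have hone : S 1 = G 1 := by
      have h1 := integral_selbergWeight_one_succ (n := n) hb hc
      rw [ih (by linarith), selbergGamma_one_succ hb0 hc0] at h1
      exact (mul_left_cancel₀ (by positivity) h1).symm
    have hnat : ∀ m : ℕ, S (1 + m) = G (1 + m) := by
      intro m
      have := hadd 1 le_rfl m
      rw [hone, mul_comm (G 1)] at this
      exact mul_right_cancel₀ (hGpos 1 le_rfl).ne' this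
    obtain ⟨N, hN⟩ := exists_nat_ge a
    have hlim : ∀ x : ℝ, 0 < x → Tendsto (fun m : ℕ =>
        G (x + m + 1) * ((m : ℝ) ^ (b + n * c)) ^ (n + 1)) atTop _ :=
      fun x hx => tendsto_selbergGamma_mul_rpow hb0 hc0 hx
    set K := ∏ j ∈ Finset.range (n + 1), Real.Gamma (b + j * c) * Real.Gamma ((j + 1) * c + 1) /
        Real.Gamma (c + 1) with hK
    have hK0 : 0 < K := Finset.prod_pos fun j _ =>
      div_pos (mul_pos (Real.Gamma_pos_of_pos (by positivity))
        (Real.Gamma_pos_of_pos (by positivity))) (Real.Gamma_pos_of_pos (by positivity))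
    have hSlim : Tendsto (fun m : ℕ => S (a + m + 1) * ((m : ℝ) ^ (b + n * c)) ^ (n + 1)) atTop
        (𝓝 K) := by
      refine tendsto_of_tendsto_of_tendsto_of_le_of_le (hlim N (by linarith)) (hlim 1 one_pos)
        (fun m => ?_) (fun m => ?_)
      · refine mul_le_mul_of_nonneg_right ?_ (by positivity)
        have := hnat (N + m)
        rw [show (1 : ℝ) + ((N + m : ℕ) : ℝ) = N + m + 1 by push_cast; ring] at this
        rw [← this]
        exact integral_selbergWeight_anti (by linarith [(Nat.cast_nonneg m : (0 : ℝ) ≤ m)])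
          (by linarith) hb hc0
      · refine mul_le_mul_of_nonneg_right ?_ (by positivity)
        have := hnat (m + 1)
        rw [show (1 : ℝ) + ((m + 1 : ℕ) : ℝ) = 1 + m + 1 by push_cast; ring] at this
        rw [← this]
        exact integral_selbergWeight_anti (by linarith [(Nat.cast_nonneg m : (0 : ℝ) ≤ m)])
          (by linarith) hb hc0
    have hSlim2 := (hlim a (by linarith)).const_mul (S a)
    have hSlim3 := hSlim.const_mul (G a)
    have heq : G a * K = S a * K := by
      refine tendsto_nhds_unique hSlim3 (hSlim2.congr fun m => ?_)
      have := hadd a ha (m + 1)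
      rw [Nat.cast_succ, ← add_assoc] at this
      linear_combination -((m : ℝ) ^ (b + n * c)) ^ (n + 1) * this
    exact (mul_right_cancel₀ hK0.ne' heq).symm

/-- The product of Gamma values in Selberg's formula, for complex parameters. -/
noncomputable def complexSelbergGamma (n : ℕ) (x y z : ℂ) : ℂ :=
  ∏ j ∈ Finset.range n, Complex.Gamma (x + j * z) * Complex.Gamma (y + j * z) *
    Complex.Gamma ((j + 1) * z + 1) /
      (Complex.Gamma (x + y + (n + j - 1) * z) * Complex.Gamma (z + 1))

/-- The real parameters for which the Selberg integral converges: exactly those for which the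
arguments of the Gamma functions in the numerator of Selberg's formula are positive. -/
def SelbergDomain (n : ℕ) (a b c : ℝ) : Prop :=
  ∀ j ∈ Finset.range n, 0 < a + j * c ∧ 0 < b + j * c ∧ 0 < (j + 1) * c + 1

/-- The logarithm of the ratio of two Selberg densities whose parameters differ by `(p, q, r)`. -/
noncomputable def selbergLog {n : ℕ} (p q r : ℝ) (t : Fin n → ℝ) : ℝ :=
  p * Real.log (∏ j, t j) + q * Real.log (∏ j, (1 - t j)) + r * Real.log (discSq t)

/-- The measure on the cube whose density is the Selberg density. -/
noncomputable def selbergMeasure (n : ℕ) (a b c : ℝ) : Measure (Fin n → ℝ) :=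
  (cubeMeasure n).withDensity fun t => ENNReal.ofReal (selbergWeight a b c t)

theorem complexSelbergGamma_ofReal (n : ℕ) (a b c : ℝ) :
    complexSelbergGamma n a b c = selbergGamma n a b c := by
  simp only [complexSelbergGamma, selbergGamma, Complex.ofReal_prod, Complex.ofReal_div,
    Complex.ofReal_mul, ← Complex.Gamma_ofReal]
  push_cast
  rfl

theorem differentiableAt_Gamma_of_re_pos {s : ℂ} (hs : 0 < s.re) :
    DifferentiableAt ℂ Complex.Gamma s := by
  refine Complex.differentiableAt_Gamma s fun m h => ?_
  rw [h, Complex.neg_re, Complex.natCast_re] at hs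
  linarith [(Nat.cast_nonneg m : (0 : ℝ) ≤ m)]

theorem differentiableAt_complexSelbergGamma {n : ℕ} {a b c p q r : ℝ} {s : ℂ}
    (h : SelbergDomain n (a + p * s.re) (b + q * s.re) (c + r * s.re)) :
    DifferentiableAt ℂ (fun s : ℂ => complexSelbergGamma n (a + p * s) (b + q * s) (c + r * s))
      s := by
  simp only [complexSelbergGamma, div_eq_mul_inv, mul_inv]
  refine DifferentiableAt.fun_finsetProd fun j hj => ?_
  obtain ⟨h1, h2, h3⟩ := h j hj
  refine .fun_mul (.fun_mul (.fun_mul ?_ ?_) ?_) (.fun_mul ?_ ?_)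
  · exact (differentiableAt_Gamma_of_re_pos (by simpa using h1)).comp s
      (f := fun s : ℂ => (a + p * s : ℂ) + j * (c + r * s)) (by fun_prop)
  · exact (differentiableAt_Gamma_of_re_pos (by simpa using h2)).comp s
      (f := fun s : ℂ => (b + q * s : ℂ) + j * (c + r * s)) (by fun_prop)
  · exact (differentiableAt_Gamma_of_re_pos (by simpa using h3)).comp s
      (f := fun s : ℂ => (j + 1 : ℂ) * (c + r * s) + 1) (by fun_prop)
  · exact (Complex.differentiable_one_div_Gamma _).comp s
      (f := fun s : ℂ => (a + p * s : ℂ) + (b + q * s) + (n + j - 1) * (c + r * s)) (by fun_prop)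
  · exact (Complex.differentiable_one_div_Gamma _).comp s
      (f := fun s : ℂ => (c + r * s : ℂ) + 1) (by fun_prop)

theorem SelbergDomain.eventually {n : ℕ} {a b c : ℝ} (h : SelbergDomain n a b c) (p q r : ℝ) :
    ∃ ε > 0, ∀ s ∈ Ioo (-ε) ε, SelbergDomain n (a + p * s) (b + q * s) (c + r * s) := by
  have : ∀ᶠ s : ℝ in 𝓝 0, SelbergDomain n (a + p * s) (b + q * s) (c + r * s) := by
    refine (Filter.eventually_all_finset _).2 fun j hj => ?_
    obtain ⟨h1, h2, h3⟩ := h j hj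
    refine .and ?_ (.and ?_ ?_)
    all_goals
      refine ContinuousAt.eventually_lt (by fun_prop) (by fun_prop) ?_
      simpa
  obtain ⟨ε, hε, h'⟩ := Metric.eventually_nhds_iff.1 this
  refine ⟨ε, hε, fun s hs => h' ?_⟩
  rw [Real.dist_eq, sub_zero]
  exact abs_lt.2 hs

theorem SelbergDomain.add_nonneg {n : ℕ} {a b c s : ℝ} (h : SelbergDomain n a b c) (hs : 0 ≤ s) :
    SelbergDomain n (a + s) (b + s) (c + s) := by
  intro j hj
  obtain ⟨h1, h2, h3⟩ := h j hj
  have h4 : 0 ≤ j * s := by positivity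
  exact ⟨by linarith, by linarith, by linarith⟩

theorem ae_cubeMeasure_generic (n : ℕ) : ∀ᵐ t ∂cubeMeasure n,
    (∀ j, 0 < t j ∧ t j < 1) ∧ ∀ i j, i ≠ j → t i ≠ t j := by
  have hne : ∀ j (u : ℝ), ∀ᵐ t : Fin n → ℝ ∂cubeMeasure n, t j ≠ u := fun j u =>
    ae_restrict_of_ae (Measure.ae_eval_ne (fun _ : Fin n => (volume : Measure ℝ)) j u)
  have hdiag : ∀ i j, ∀ᵐ t : Fin n → ℝ ∂cubeMeasure n, i ≠ j → t i ≠ t j := by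
    intro i j
    by_cases hij : i = j
    · simp [hij]
    refine ae_restrict_of_ae ?_
    let S : Submodule ℝ (Fin n → ℝ) :=
      LinearMap.ker ((LinearMap.proj i : (Fin n → ℝ) →ₗ[ℝ] ℝ) - LinearMap.proj j)
    have hS : S ≠ ⊤ := by
      intro hS
      have : (Pi.single i 1 : Fin n → ℝ) ∈ S := hS ▸ Submodule.mem_top
      simp [S, Pi.single_eq_of_ne' hij] at this
    have h0 : volume (S : Set (Fin n → ℝ)) = 0 := Measure.addHaar_submodule _ S hS
    filter_upwards [measure_eq_zero_iff_ae_notMem.1 h0] with t ht _ hij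
    exact ht (by simp [S, hij])
  filter_upwards [ae_cubeMeasure_mem n, ae_all_iff.2 fun j => hne j 0,
    ae_all_iff.2 fun j => hne j 1, ae_all_iff.2 fun i => ae_all_iff.2 fun j => hdiag i j]
    with t ht h0 h1 h2
  exact ⟨fun j => ⟨(ht.1 j).lt_of_ne' (h0 j), (ht.2 j).lt_of_ne (h1 j)⟩, h2⟩

theorem discSq_pos {n : ℕ} {t : Fin n → ℝ} (h : ∀ i j, i ≠ j → t i ≠ t j) : 0 < discSq t := by
  refine sq_pos_of_ne_zero fun h0 => ?_
  obtain ⟨i, j, hij, hne⟩ := Matrix.det_vandermonde_eq_zero_iff.1 h0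
  exact h i j hne hij

theorem ae_cubeMeasure_pos (n : ℕ) : ∀ᵐ t ∂cubeMeasure n,
    0 < ∏ j, t j ∧ 0 < ∏ j, (1 - t j) ∧ 0 < discSq t := by
  filter_upwards [ae_cubeMeasure_generic n] with t ht
  exact ⟨Finset.prod_pos fun j _ => (ht.1 j).1,
    Finset.prod_pos fun j _ => sub_pos.2 (ht.1 j).2, discSq_pos ht.2⟩

theorem selbergWeight_mul_exp {n : ℕ} {a b c p q r s : ℝ} {t : Fin n → ℝ} (h1 : 0 < ∏ j, t j)
    (h2 : 0 < ∏ j, (1 - t j)) (h3 : 0 < discSq t) :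
    selbergWeight a b c t * Real.exp (s * selbergLog p q r t)
      = selbergWeight (a + p * s) (b + q * s) (c + r * s) t := by
  simp only [selbergWeight, selbergLog, Real.rpow_def_of_pos h1, Real.rpow_def_of_pos h2,
    Real.rpow_def_of_pos h3, ← Real.exp_add]
  congr 1
  ring

theorem measurable_selbergLog (n : ℕ) (p q r : ℝ) :
    Measurable (selbergLog p q r : (Fin n → ℝ) → ℝ) := by
  have := measurable_discSq n
  unfold selbergLog
  fun_prop

theorem ae_selbergMeasure_toReal_ofReal (n : ℕ) (a b c : ℝ) : ∀ᵐ t ∂cubeMeasure n,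
    (ENNReal.ofReal (selbergWeight a b c t)).toReal = selbergWeight a b c t := by
  filter_upwards [ae_cubeMeasure_mem n] with t ht
  exact ENNReal.toReal_ofReal (selbergWeight_nonneg a b c ht)

theorem integral_selbergMeasure {n : ℕ} {a b c : ℝ} {E : Type*} [NormedAddCommGroup E]
    [NormedSpace ℝ E] (f : (Fin n → ℝ) → E) :
    ∫ t, f t ∂selbergMeasure n a b c = ∫ t, selbergWeight a b c t • f t ∂cubeMeasure n := by
  rw [selbergMeasure, integral_withDensity_eq_integral_toReal_smul
    (measurable_selbergWeight n a b c).ennreal_ofReal (by simp)]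
  refine integral_congr_ae ?_
  filter_upwards [ae_selbergMeasure_toReal_ofReal n a b c] with t ht
  rw [ht]

theorem integrable_exp_selbergLog_iff {n : ℕ} {a b c p q r s : ℝ} :
    Integrable (fun t => Real.exp (s * selbergLog p q r t)) (selbergMeasure n a b c) ↔
      Integrable (selbergWeight (a + p * s) (b + q * s) (c + r * s)) (cubeMeasure n) := by
  rw [selbergMeasure, integrable_withDensity_iff_integrable_smul'
    (measurable_selbergWeight n a b c).ennreal_ofReal (by simp)]
  refine integrable_congr ?_
  filter_upwards [ae_selbergMeasure_toReal_ofReal n a b c, ae_cubeMeasure_pos n]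
    with t ht ⟨h1, h2, h3⟩
  rw [ht, smul_eq_mul, selbergWeight_mul_exp h1 h2 h3]

theorem complexMGF_selbergLog_ofReal {n : ℕ} {a b c p q r s : ℝ} :
    complexMGF (selbergLog p q r) (selbergMeasure n a b c) s
      = (∫ t, selbergWeight (a + p * s) (b + q * s) (c + r * s) t ∂cubeMeasure n : ℝ) := by
  rw [complexMGF_ofReal, mgf, integral_selbergMeasure]
  congr 1
  refine integral_congr_ae ?_
  filter_upwards [ae_cubeMeasure_pos n] with t ⟨h1, h2, h3⟩
  rw [smul_eq_mul, selbergWeight_mul_exp h1 h2 h3]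

/-- Selberg's formula for all real parameters in the domain of convergence. -/
theorem integral_selbergWeight {n : ℕ} {a b c : ℝ} (h : SelbergDomain n a b c) :
    Integrable (selbergWeight a b c) (cubeMeasure n) ∧
      ∫ t, selbergWeight a b c t ∂cubeMeasure n = selbergGamma n a b c := by
  obtain ⟨ε, hε, hdom⟩ := h.eventually 1 1 1
  have hdom' : ∀ s, -ε < s → SelbergDomain n (a + 1 * s) (b + 1 * s) (c + 1 * s) := by
    intro s hs
    rcases lt_or_ge s ε with h1 | h1
    · exact hdom s ⟨hs, h1⟩
    · simpa using h.add_nonneg (hε.le.trans h1)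
  have hlarge : ∀ s, |a| + |b| + |c| + 1 < s → 1 ≤ a + 1 * s ∧ 1 ≤ b + 1 * s ∧ 1 ≤ c + 1 * s := by
    intro s hs
    have := neg_abs_le a
    have := neg_abs_le b
    have := neg_abs_le c
    have := abs_nonneg a
    have := abs_nonneg b
    have := abs_nonneg c
    exact ⟨by linarith, by linarith, by linarith⟩
  have key := integrable_exp_mul_and_complexMGF_eq_of_continuation
    (ν := selbergMeasure n a b c) (X := selbergLog 1 1 1) (s₁ := |a| + |b| + |c| + 1)
    (G := fun s : ℂ => complexSelbergGamma n (a + (1 : ℝ) * s) (b + (1 : ℝ) * s) (c + (1 : ℝ) * s))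
    (s := 0) (measurable_selbergLog n 1 1 1).aemeasurable ?_
    (fun s hs => (differentiableAt_complexSelbergGamma
      (hdom' s.re hs)).differentiableWithinAt) ?_ ?_ (neg_lt_zero.2 hε)
  · rw [integrable_exp_selbergLog_iff, complexMGF_selbergLog_ofReal] at key
    simp only [mul_zero, add_zero, Complex.ofReal_zero, complexSelbergGamma_ofReal,
      Complex.ofReal_inj] at key
    exact key
  · refine (withDensity_absolutelyContinuous _ _).ae_le ?_
    filter_upwards [ae_cubeMeasure_mem n] with t ht
    have h1 := prod_mem_Icc_of_mem_cube ht Finset.univ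
    have h2 := prod_one_sub_mem_Icc_of_mem_cube ht
    have := Real.log_nonpos h1.1 h1.2
    have := Real.log_nonpos h2.1 h2.2
    have := Real.log_nonpos (discSq_nonneg t) (discSq_le_one ht)
    rw [selbergLog]
    linarith
  · intro s hs
    obtain ⟨h1, h2, h3⟩ := hlarge s hs
    exact integrable_exp_selbergLog_iff.2 (integrable_selbergWeight h1 h2 (by linarith))
  · intro s hs
    obtain ⟨h1, h2, h3⟩ := hlarge s hs
    rw [complexMGF_selbergLog_ofReal, integral_selbergWeight_of_one_le n h1 h2 h3,
      ← complexSelbergGamma_ofReal]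
    push_cast
    rfl

theorem integral_selbergWeight_mul_cexp {n : ℕ} {x y z : ℂ} (h : SelbergDomain n x.re y.re z.re) :
    ∫ t, (selbergWeight x.re y.re z.re t : ℂ) *
      Complex.exp (Complex.I * selbergLog x.im y.im z.im t) ∂cubeMeasure n
      = complexSelbergGamma n x y z := by
  obtain ⟨ε, hε, hdom⟩ := h.eventually x.im y.im z.im
  have h0 : (0 : ℝ) ∈ Ioo (-ε) ε := ⟨neg_lt_zero.2 hε, hε⟩
  have key := complexMGF_eqOn_of_eventually_ofReal (ν := selbergMeasure n x.re y.re z.re)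
    (X := selbergLog x.im y.im z.im) (I := Ioo (-ε) ε) isOpen_Ioo (convex_Ioo _ _)
    (G := fun s : ℂ => complexSelbergGamma n (x.re + x.im * s) (y.re + y.im * s)
      (z.re + z.im * s))
    (fun s hs => (differentiableAt_complexSelbergGamma
      (hdom s.re hs)).differentiableWithinAt)
    (fun s hs => integrable_exp_selbergLog_iff.2 (integral_selbergWeight (hdom s hs)).1) h0 ?_
    (show Complex.I ∈ {s : ℂ | s.re ∈ Ioo (-ε) ε} by simpa using h0)
  · simp only [complexMGF, integral_selbergMeasure, Complex.re_add_im, Complex.real_smul] at key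
    exact key
  · filter_upwards [isOpen_Ioo.mem_nhds h0] with s hs
    rw [complexMGF_selbergLog_ofReal, (integral_selbergWeight (hdom s hs)).2,
      ← complexSelbergGamma_ofReal]
    push_cast
    rfl

theorem selbergDomain_of_lt {n : ℕ} {a b c : ℝ} (ha : 0 < a) (hb : 0 < b)
    (hc : if n = 1 then -1 < c else
      -min (1 / (n : ℝ)) (min (a / ((n : ℝ) - 1)) (b / ((n : ℝ) - 1))) < c) :
    SelbergDomain n a b c := by
  intro j hj
  have hjn : j + 1 ≤ n := Finset.mem_range.1 hj
  have hj' : (j : ℝ) + 1 ≤ n := by exact_mod_cast hjn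
  have hj0 : (0 : ℝ) ≤ j := Nat.cast_nonneg j
  rcases le_or_gt 0 c with h0 | h0
  · exact ⟨by positivity, by positivity, by positivity⟩
  split_ifs at hc with h1
  · obtain rfl : j = 0 := by omega
    simp only [Nat.cast_zero, zero_mul, add_zero]
    exact ⟨ha, hb, by linarith⟩
  · have hn : (1 : ℝ) < n := by exact_mod_cast (by omega : 1 < n)
    have hn1 : 0 < (n : ℝ) - 1 := sub_pos.2 hn
    rw [neg_lt, lt_min_iff, lt_min_iff, lt_div_iff₀ (by linarith), lt_div_iff₀ hn1,
      lt_div_iff₀ hn1] at hc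
    obtain ⟨h2, h3, h4⟩ := hc
    exact ⟨by nlinarith, by nlinarith, by nlinarith⟩

theorem selberg_integrand_eq {n : ℕ} {t : Fin n → ℝ} (ht : ∀ j, 0 < t j ∧ t j < 1)
    (hne : ∀ i j, i ≠ j → t i ≠ t j) (x y z : ℂ) :
    (∏ j : Fin n, ((t j : ℂ) ^ (x - 1) * ((1 : ℂ) - (t j : ℂ)) ^ (y - 1))) *
        ∏ j : Fin n, ∏ l ∈ Finset.Ioi j, ((|t j - t l| : ℝ) : ℂ) ^ (2 * z)
      = (selbergWeight x.re y.re z.re t : ℂ) *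
        Complex.exp (Complex.I * selbergLog x.im y.im z.im t) := by
  have hpow : ∀ {u : ℝ}, 0 < u → ∀ w : ℂ, (u : ℂ) ^ w = Complex.exp (w * Real.log u) := by
    intro u hu w
    rw [Complex.cpow_def_of_ne_zero (by exact_mod_cast hu.ne'), ← Complex.ofReal_log hu.le,
      mul_comm]
  have hu : ∀ j, 0 < 1 - t j := fun j => sub_pos.2 (ht j).2
  have h1 : 0 < ∏ j, t j := Finset.prod_pos fun j _ => (ht j).1
  have h2 : 0 < ∏ j, (1 - t j) := Finset.prod_pos fun j _ => hu j
  have h3 := discSq_pos hne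
  have hd : ∀ j, ∀ l ∈ Finset.Ioi j, 0 < |t j - t l| := fun j l hl =>
    abs_pos.2 (sub_ne_zero.2 (hne j l (Finset.mem_Ioi.1 hl).ne))
  have hD : Real.log (discSq t) = 2 * ∑ j, ∑ l ∈ Finset.Ioi j, Real.log |t j - t l| := by
    rw [discSq, Matrix.det_vandermonde, Real.log_pow, Nat.cast_ofNat, Real.log_prod fun j _ =>
      Finset.prod_ne_zero_iff.2 fun l hl => sub_ne_zero.2 (hne l j (Finset.mem_Ioi.1 hl).ne')]
    congr 1
    refine Finset.sum_congr rfl fun j _ => ?_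
    rw [Real.log_prod fun l hl => sub_ne_zero.2 (hne l j (Finset.mem_Ioi.1 hl).ne')]
    refine Finset.sum_congr rfl fun l _ => ?_
    rw [Real.log_abs, ← Real.log_neg_eq_log, neg_sub]
  have e1 : ∏ j, (t j : ℂ) ^ (x - 1) = Complex.exp ((x - 1) * Real.log (∏ j, t j)) := by
    rw [Real.log_prod fun j _ => (ht j).1.ne', Complex.ofReal_sum, Finset.mul_sum,
      Complex.exp_sum]
    exact Finset.prod_congr rfl fun j _ => hpow (ht j).1 _
  have e2 : ∏ j, ((1 : ℂ) - t j) ^ (y - 1)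
      = Complex.exp ((y - 1) * Real.log (∏ j, (1 - t j))) := by
    rw [Real.log_prod fun j _ => (hu j).ne', Complex.ofReal_sum, Finset.mul_sum,
      Complex.exp_sum]
    refine Finset.prod_congr rfl fun j _ => ?_
    rw [← hpow (hu j), Complex.ofReal_sub, Complex.ofReal_one]
  have e3 : ∏ j : Fin n, ∏ l ∈ Finset.Ioi j, ((|t j - t l| : ℝ) : ℂ) ^ (2 * z)
      = Complex.exp (z * Real.log (discSq t)) := by
    rw [hD, Complex.ofReal_mul, Complex.ofReal_sum, mul_left_comm, Finset.mul_sum, Finset.mul_sum,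
      Complex.exp_sum]
    refine Finset.prod_congr rfl fun j _ => ?_
    rw [Complex.ofReal_sum, Finset.mul_sum, Finset.mul_sum, Complex.exp_sum]
    refine Finset.prod_congr rfl fun l hl => ?_
    rw [hpow (hd j l hl), mul_assoc, Complex.ofReal_ofNat, mul_left_comm]
  rw [Finset.prod_mul_distrib, e1, e2, e3]
  simp only [selbergWeight, selbergLog, Real.rpow_def_of_pos h1, Real.rpow_def_of_pos h2,
    Real.rpow_def_of_pos h3, ← Real.exp_add]
  rw [Complex.ofReal_exp, ← Complex.exp_add, ← Complex.exp_add, ← Complex.exp_add]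
  congr 1
  conv_lhs => rw [← Complex.re_add_im x, ← Complex.re_add_im y, ← Complex.re_add_im z]
  push_cast
  ring

end

/-- Selberg's integral: for `Re x > 0`, `Re y > 0` and
`Re z > -min(1/n, Re x/(n-1), Re y/(n-1))` (for `n = 1` the condition is `Re z > -1`),
`∫_{[0,1]^n} ∏ t_j^{x-1}(1-t_j)^{y-1} ∏_{j<k} |t_j-t_k|^{2z} dt
  = ∏_{j=1}^n Γ(x+(j-1)z)Γ(y+(j-1)z)Γ(jz+1) / (Γ(x+y+(n+j-2)z)Γ(z+1))`.
Here the index `j : Fin n` corresponds to `j+1` in the classical notation. -/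
theorem selberg_integral (n : ℕ) (hn : 0 < n) (x y z : ℂ)
    (hx : 0 < x.re) (hy : 0 < y.re)
    (hz : if n = 1 then -1 < z.re else
      -min (1 / (n : ℝ)) (min (x.re / ((n : ℝ) - 1)) (y.re / ((n : ℝ) - 1))) < z.re) :
    ∫ t : Fin n → ℝ in Set.Icc 0 1,
        (∏ j : Fin n, ((t j : ℂ) ^ (x - 1) * ((1 : ℂ) - (t j : ℂ)) ^ (y - 1))) *
          ∏ j : Fin n, ∏ l ∈ Finset.Ioi j, ((|t j - t l| : ℝ) : ℂ) ^ (2 * z)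
      = ∏ j : Fin n,
          Complex.Gamma (x + (j : ℂ) * z) * Complex.Gamma (y + (j : ℂ) * z) *
              Complex.Gamma (((j : ℂ) + 1) * z + 1) /
            (Complex.Gamma (x + y + ((n : ℂ) + (j : ℂ) - 1) * z) * Complex.Gamma (z + 1)) := by
  rw [Fin.prod_univ_eq_prod_range (fun j : ℕ => Complex.Gamma (x + (j : ℂ) * z) *
    Complex.Gamma (y + (j : ℂ) * z) * Complex.Gamma (((j : ℂ) + 1) * z + 1) /
    (Complex.Gamma (x + y + ((n : ℂ) + (j : ℂ) - 1) * z) * Complex.Gamma (z + 1))) n]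
  refine Eq.trans ?_ (integral_selbergWeight_mul_cexp (selbergDomain_of_lt hx hy hz))
  refine integral_congr_ae ?_
  filter_upwards [ae_cubeMeasure_generic n] with t ht
  exact selberg_integrand_eq ht.1 ht.2 x y z
end

section
/- Let r be a positive integer, let a and b be nonnegative real numbers, and let s be a complex number with Re s > -1. Then ∫_{1>λ_1>λ_2>⋯>λ_r>0} ∏_{j=1}^r (1-λ_j^2)^s λ_j^{2b+1} ∏_{1≤j<k≤r} (λ_j^2-λ_k^2)^a dλ_1 ⋯ dλ_r = (1/(2^r r!)) ∏_{j=1}^r [Γ(b+1+(j-1)a/2) Γ(s+1+(j-1)a/2) Γ(j·a/2+1)] / [Γ(s+b+2+(r+j-2)a/2) Γ(a/2+1)]. -/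
open MeasureTheory Complex

section Interlacing

open Finset Polynomial

/-- The product of the differences `t i - t j` over `i < j`. -/
noncomputable def diffProd {n : ℕ} (t : Fin n → ℝ) : ℝ :=
  ∏ i, ∏ j ∈ Ioi i, (t i - t j)

lemma diffProd_pos {n : ℕ} {t : Fin n → ℝ} (ht : StrictAnti t) : 0 < diffProd t :=
  prod_pos fun _ _ => prod_pos fun _ hj => sub_pos.2 (ht (mem_Ioi.1 hj))

lemma abs_det_vandermonde {n : ℕ} (t : Fin n → ℝ) :
    |(Matrix.vandermonde t).det| = |diffProd t| := by
  rw [Matrix.det_vandermonde, diffProd]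
  simp_rw [abs_prod, abs_sub_comm]

lemma prod_erase_univ_eq_prod_succAbove {M : Type*} [CommMonoid M] {n : ℕ} (j : Fin (n + 1))
    (f : Fin (n + 1) → M) : ∏ k ∈ univ.erase j, f k = ∏ i, f (j.succAbove i) := by
  rw [← Finset.compl_singleton, ← Fin.image_succAbove_univ,
    prod_image fun _ _ _ _ h => Fin.succAbove_right_injective h]

lemma prod_erase_abs_sub {n : ℕ} (t : Fin n → ℝ) :
    ∏ i, ∏ j ∈ univ.erase i, |t i - t j| = diffProd t ^ 2 := by
  have h := prod_prod_Ioi_mul_eq_prod_prod_off_diag (fun j i : Fin n => |t i - t j|)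
  simp_rw [Finset.compl_singleton] at h
  rw [← h, ← sq_abs, diffProd, sq]
  simp_rw [abs_prod, prod_mul_distrib, abs_sub_comm]

/-- Both sides are determinants of values at the points `y` of the monic polynomials
vanishing on all but one of the points `t`. -/
lemma abs_det_prod_erase_sub {n : ℕ} (y t : Fin n → ℝ) (ht : StrictAnti t) :
    |(Matrix.of fun j i => ∏ l ∈ univ.erase i, (y j - t l)).det| = |diffProd y| * diffProd t := by
  set p : Fin n → ℝ[X] := fun i => ∏ l ∈ univ.erase i, (X - C (t l)) with hp
  set c : Matrix (Fin n) (Fin n) ℝ := Matrix.of fun k i => (p i).coeff k with hc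
  have hfac (y : Fin n → ℝ) :
      (Matrix.of fun j i => ∏ l ∈ univ.erase i, (y j - t l)) = Matrix.vandermonde y * c := by
    ext j i
    have hdeg : (p i).natDegree < n := by
      have hi := i.pos
      rw [hp, natDegree_prod_of_monic _ _ fun l _ => monic_X_sub_C _]
      simp
      omega
    have hev : (p i).eval (y j) = ∏ l ∈ univ.erase i, (y j - t l) := by
      simp [hp, eval_prod]
    rw [Matrix.of_apply, ← hev, eval_eq_sum_range' hdeg, Matrix.mul_apply, ← Fin.sum_univ_eq_sum_range
      (fun k => (p i).coeff k * y j ^ k)]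
    exact sum_congr rfl fun k _ => by rw [Matrix.vandermonde_apply, hc, Matrix.of_apply, mul_comm]
  have hself : |(Matrix.of fun j i => ∏ l ∈ univ.erase i, (t j - t l)).det| = diffProd t ^ 2 := by
    have hdiag : (Matrix.of fun j i => ∏ l ∈ univ.erase i, (t j - t l)) =
        Matrix.diagonal fun i => ∏ l ∈ univ.erase i, (t i - t l) := by
      ext j i
      rcases eq_or_ne j i with rfl | hji
      · simp
      · rw [Matrix.diagonal_apply_ne _ hji, Matrix.of_apply]
        exact prod_eq_zero (mem_erase.2 ⟨hji, mem_univ _⟩) (sub_self _)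
    rw [hdiag, Matrix.det_diagonal, abs_prod]
    simp_rw [abs_prod]
    exact prod_erase_abs_sub t
  have hpos := diffProd_pos ht
  have hcdet : |c.det| = diffProd t := by
    rw [hfac, Matrix.det_mul, abs_mul, abs_det_vandermonde, abs_of_pos hpos, sq] at hself
    exact mul_left_cancel₀ hpos.ne' hself
  rw [hfac, Matrix.det_mul, abs_mul, abs_det_vandermonde, hcdet]

/-- The residue at `a j` of `∏ i, (z - t i) / ∏ k, (z - a k)`. -/
noncomputable def residue {n : ℕ} (a : Fin (n + 1) → ℝ) (t : Fin n → ℝ) (j : Fin (n + 1)) : ℝ :=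
  ∏ i, (a j - t i) / (a j - a (j.succAbove i))

/-- The points `t` interlacing with `a`. -/
def interlacing {n : ℕ} (a : Fin (n + 1) → ℝ) : Set (Fin n → ℝ) :=
  Set.univ.pi fun i => Set.Ioo (a i.succ) (a i.castSucc)

variable {n : ℕ} {a : Fin (n + 1) → ℝ} {t u : Fin n → ℝ}

lemma mem_interlacing : t ∈ interlacing a ↔ ∀ i, a i.succ < t i ∧ t i < a i.castSucc := by
  simp [interlacing, Set.mem_pi]

lemma measurableSet_interlacing : MeasurableSet (interlacing a) :=
  MeasurableSet.univ_pi fun _ => measurableSet_Ioo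

lemma lt_castSucc_iff_of_mem_interlacing (ha : StrictAnti a) (ht : t ∈ interlacing a)
    (j : Fin (n + 1)) (i : Fin n) :
    (i.castSucc < j → a j < t i) ∧ (j ≤ i.castSucc → t i < a j) := by
  rw [mem_interlacing] at ht
  refine ⟨fun h => (ha.antitone ?_).trans_lt (ht i).1, fun h => (ht i).2.trans_le (ha.antitone h)⟩
  exact Fin.castSucc_lt_iff_succ_le.1 h

lemma strictAnti_of_mem_interlacing (ha : StrictAnti a) (ht : t ∈ interlacing a) :
    StrictAnti t := by
  intro i k hik
  have h1 := (mem_interlacing.1 ht i).1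
  exact ((lt_castSucc_iff_of_mem_interlacing ha ht i.succ k).2 (by
    rw [Fin.le_def]; simpa using hik)).trans h1

lemma residue_pos (ha : StrictAnti a) (ht : t ∈ interlacing a) (j : Fin (n + 1)) :
    0 < residue a t j := by
  refine prod_pos fun i _ => ?_
  have h := lt_castSucc_iff_of_mem_interlacing ha ht j i
  rcases lt_or_ge i.castSucc j with hij | hij
  · rw [Fin.succAbove_of_castSucc_lt _ _ hij]
    exact div_pos_of_neg_of_neg (sub_neg.2 (h.1 hij)) (sub_neg.2 (ha hij))
  · rw [Fin.succAbove_of_le_castSucc _ _ hij]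
    refine div_pos (sub_pos.2 (h.2 hij)) (sub_pos.2 (ha ?_))
    exact hij.trans_lt (Fin.castSucc_lt_succ)

lemma monic_prod_X_sub_C' (t : Fin n → ℝ) : (∏ i, (X - C (t i))).Monic :=
  monic_prod_of_monic _ _ fun i _ => monic_X_sub_C (t i)

lemma natDegree_prod_X_sub_C' (t : Fin n → ℝ) : (∏ i, (X - C (t i))).natDegree = n := by
  simp

lemma sum_residue (ha : StrictAnti a) (t : Fin n → ℝ) : ∑ j, residue a t j = 1 := by
  have hdeg : (∏ i, (X - C (t i))).degree < (#(univ : Finset (Fin (n + 1))) : WithBot ℕ) := by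
    rw [degree_eq_natDegree (monic_prod_X_sub_C' t).ne_zero, natDegree_prod_X_sub_C']
    simp
    norm_cast
    omega
  have h := Lagrange.coeff_eq_sum (s := univ) (v := a) ha.injective.injOn hdeg
  have h1 : (∏ i, (X - C (t i))).coeff (#(univ : Finset (Fin (n + 1))) - 1) = 1 := by
    have := (monic_prod_X_sub_C' t).coeff_natDegree
    rw [natDegree_prod_X_sub_C'] at this
    simpa using this
  rw [h1] at h
  rw [h]
  refine sum_congr rfl fun j _ => ?_
  rw [prod_erase_univ_eq_prod_succAbove, eval_prod, residue, prod_div_distrib]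
  simp

lemma residue_mul_prod (ha : StrictAnti a) (t : Fin n → ℝ) (j : Fin (n + 1)) :
    residue a t j * ∏ i, (a j - a (j.succAbove i)) = ∏ i, (a j - t i) := by
  rw [residue, ← prod_mul_distrib]
  refine prod_congr rfl fun i _ => div_mul_cancel₀ _ (sub_ne_zero.2 fun h => ?_)
  exact (Fin.succAbove_ne j i) (ha.injective h).symm

lemma injOn_residue_succ (ha : StrictAnti a) :
    Set.InjOn (fun (t : Fin n → ℝ) (j : Fin n) => residue a t j.succ) (interlacing a) := by
  intro t ht u hu htu
  have hpoly : (∏ i, (X - C (t i))) = ∏ i, (X - C (u i)) := by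
    refine Polynomial.eq_of_degree_le_of_eval_index_eq (v := fun i : Fin n => a i.succ) univ
      (ha.injective.comp (Fin.succ_injective n)).injOn ?_ ?_ ?_ ?_
    · rw [degree_eq_natDegree (monic_prod_X_sub_C' t).ne_zero, natDegree_prod_X_sub_C']
      simp
    · rw [degree_eq_natDegree (monic_prod_X_sub_C' t).ne_zero, natDegree_prod_X_sub_C',
        degree_eq_natDegree (monic_prod_X_sub_C' u).ne_zero, natDegree_prod_X_sub_C']
    · rw [(monic_prod_X_sub_C' t).leadingCoeff, (monic_prod_X_sub_C' u).leadingCoeff]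
    · intro j _
      simp only [eval_prod, eval_sub, eval_X, eval_C]
      rw [← residue_mul_prod ha t, ← residue_mul_prod ha u]
      exact congrArg (· * ∏ i, (a j.succ - a (j.succ.succAbove i))) (congrFun htu j)
  ext i
  have h0 : (∏ k, (X - C (u k))).eval (t i) = 0 := by
    rw [← hpoly, eval_prod]
    exact prod_eq_zero (mem_univ i) (by simp)
  rw [eval_prod, prod_eq_zero_iff] at h0
  obtain ⟨k, -, hk⟩ := h0
  have hk : t i = u k := by simpa [sub_eq_zero] using hk
  have h1 := mem_interlacing.1 ht i
  have h2 := mem_interlacing.1 hu k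
  rcases lt_trichotomy i k with h | h | h
  · have := ha.antitone (show i.succ ≤ k.castSucc by rw [Fin.le_def]; simpa using h)
    linarith [h1.1, h2.2]
  · rw [hk, h]
  · have := ha.antitone (show k.succ ≤ i.castSucc by rw [Fin.le_def]; simpa using h)
    linarith [h1.2, h2.1]

lemma prod_succAbove_mul_prod_succAbove_neg (ha : StrictAnti a) (i : Fin n) :
    (∏ l, (a i.castSucc - a (i.castSucc.succAbove l))) *
      ∏ l, (a i.succ - a (i.succ.succAbove l)) < 0 := by
  rw [← prod_mul_distrib, ← mul_prod_erase univ _ (mem_univ i)]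
  refine mul_neg_of_neg_of_pos ?_ (prod_pos fun l hl => ?_)
  · have h := ha (Fin.castSucc_lt_succ (i := i))
    rw [Fin.succAbove_castSucc_self, Fin.succAbove_succ_self]
    exact mul_neg_of_pos_of_neg (sub_pos.2 h) (sub_neg.2 h)
  · rcases lt_or_gt_of_ne (ne_of_mem_erase hl) with h | h
    · rw [Fin.succAbove_castSucc_of_lt _ _ h,
        Fin.succAbove_of_castSucc_lt _ _ (by rw [Fin.lt_def] at h ⊢; simp; omega)]
      exact mul_pos_of_neg_of_neg (sub_neg.2 (ha (by simpa using h)))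
        (sub_neg.2 (ha (by rw [Fin.lt_def] at h ⊢; simp; omega)))
    · rw [Fin.succAbove_castSucc_of_le _ _ h.le,
        Fin.succAbove_of_lt_succ _ _ (by simpa using h)]
      exact mul_pos (sub_pos.2 (ha (by rw [Fin.lt_def] at h ⊢; simp; omega)))
        (sub_pos.2 (ha (by simpa using h)))

lemma exists_mem_interlacing_residue_eq (ha : StrictAnti a) {w : Fin (n + 1) → ℝ}
    (hw : ∀ j, 0 < w j) (hsum : ∑ j, w j = 1) :
    ∃ t ∈ interlacing a, residue a t = w := by
  set P : ℝ[X] := ∑ j, C (w j) * ∏ i, (X - C (a (j.succAbove i))) with hP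
  have heval (m : Fin (n + 1)) : P.eval (a m) = w m * ∏ i, (a m - a (m.succAbove i)) := by
    rw [hP, eval_finsetSum, sum_eq_single m]
    · simp [eval_prod]
    · intro j _ hj
      obtain ⟨i, hi⟩ := Fin.exists_succAbove_eq hj.symm
      rw [eval_mul, eval_prod, prod_eq_zero (mem_univ i) (by simp [hi]), mul_zero]
    · simp
  have hroot (i : Fin n) : ∃ x, (a i.succ < x ∧ x < a i.castSucc) ∧ P.eval x = 0 := by
    have hlt := ha (Fin.castSucc_lt_succ (i := i))
    have hneg : P.eval (a i.castSucc) * P.eval (a i.succ) < 0 := by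
      rw [heval, heval, mul_mul_mul_comm]
      exact mul_neg_of_pos_of_neg (mul_pos (hw _) (hw _))
        (prod_succAbove_mul_prod_succAbove_neg ha i)
    have hcont : ContinuousOn (fun x => P.eval x) (Set.Icc (a i.succ) (a i.castSucc)) :=
      P.continuous.continuousOn
    rcases mul_neg_iff.1 hneg with ⟨h1, h2⟩ | ⟨h1, h2⟩
    · obtain ⟨x, hx, hx0⟩ := intermediate_value_Ioo hlt.le hcont ⟨h2, h1⟩
      exact ⟨x, hx, hx0⟩
    · obtain ⟨x, hx, hx0⟩ := intermediate_value_Ioo' hlt.le hcont ⟨h1, h2⟩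
      exact ⟨x, hx, hx0⟩
  choose t ht ht0 using hroot
  have htmem : t ∈ interlacing a := mem_interlacing.2 ht
  refine ⟨t, htmem, ?_⟩
  have hPdeg : P.natDegree ≤ n := by
    refine natDegree_sum_le_of_forall_le _ _ fun j _ => ?_
    refine (natDegree_C_mul_le _ _).trans ?_
    rw [natDegree_prod_X_sub_C']
  have hPcoeff : P.coeff n = 1 := by
    rw [hP, finsetSum_coeff, ← hsum]
    refine sum_congr rfl fun j _ => ?_
    have h := (monic_prod_X_sub_C' fun i => a (j.succAbove i)).coeff_natDegree
    rw [natDegree_prod_X_sub_C'] at h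
    rw [coeff_C_mul, h, mul_one]
  have hPmonic : P.Monic := monic_of_natDegree_le_of_coeff_eq_one n hPdeg hPcoeff
  have hPnat : P.natDegree = n :=
    le_antisymm hPdeg (le_natDegree_of_ne_zero (by rw [hPcoeff]; exact one_ne_zero))
  have hpoly : P = ∏ i, (X - C (t i)) := by
    refine eq_of_degree_le_of_eval_index_eq (v := t) univ
      (strictAnti_of_mem_interlacing ha htmem).injective.injOn ?_ ?_ ?_ ?_
    · rw [degree_eq_natDegree hPmonic.ne_zero, hPnat]
      simp
    · rw [degree_eq_natDegree (monic_prod_X_sub_C' t).ne_zero, natDegree_prod_X_sub_C',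
        degree_eq_natDegree hPmonic.ne_zero, hPnat]
    · rw [(monic_prod_X_sub_C' t).leadingCoeff, hPmonic.leadingCoeff]
    · intro j _
      rw [ht0, eval_prod, prod_eq_zero (mem_univ j) (by simp)]
  ext m
  have hm := heval m
  rw [hpoly, eval_prod] at hm
  simp only [eval_sub, eval_X, eval_C] at hm
  rw [← residue_mul_prod ha] at hm
  refine mul_right_cancel₀ (prod_ne_zero_iff.2 fun i _ => sub_ne_zero.2 fun h => ?_) hm
  exact (Fin.succAbove_ne m i) (ha.injective h).symm

lemma image_residue_succ (ha : StrictAnti a) :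
    (fun (t : Fin n → ℝ) (j : Fin n) => residue a t j.succ) '' interlacing a =
      {w | (∀ j, 0 < w j) ∧ ∑ j, w j < 1} := by
  ext w
  constructor
  · rintro ⟨t, ht, rfl⟩
    refine ⟨fun j => residue_pos ha ht _, ?_⟩
    have h := sum_residue ha t
    rw [Fin.sum_univ_succ] at h
    linarith [residue_pos ha ht 0]
  · rintro ⟨hw, hsum⟩
    obtain ⟨t, ht, htw⟩ := exists_mem_interlacing_residue_eq ha
      (w := Fin.cons (1 - ∑ j, w j) w) (by
        refine Fin.cases ?_ ?_
        · simpa using hsum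
        · simpa using hw) (by simp [Fin.sum_univ_succ])
    refine ⟨t, ht, ?_⟩
    ext j
    simp [htw]

/-- The Jacobian matrix of the residues at `a 1, …, a n`. -/
noncomputable def residueJacobian (a : Fin (n + 1) → ℝ) (t : Fin n → ℝ) :
    Matrix (Fin n) (Fin n) ℝ :=
  Matrix.of fun j i => -((∏ k, (a j.succ - a (j.succ.succAbove k)))⁻¹ *
    ∏ l ∈ univ.erase i, (a j.succ - t l))

lemma hasFDerivAt_residue_succ (a : Fin (n + 1) → ℝ) (t : Fin n → ℝ) :
    HasFDerivAt (fun (t : Fin n → ℝ) (j : Fin n) => residue a t j.succ)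
      (LinearMap.toContinuousLinearMap (Matrix.toLin' (residueJacobian a t))) t := by
  rw [hasFDerivAt_pi']
  intro j
  have h1 (i : Fin n) : HasFDerivAt (fun t : Fin n → ℝ => a j.succ - t i)
      (-ContinuousLinearMap.proj (R := ℝ) (φ := fun _ : Fin n => ℝ) i) t :=
    (hasFDerivAt_apply i t).const_sub _
  have h2 := (HasFDerivAt.finsetProd (u := univ) fun i _ => h1 i).const_mul
    (∏ k, (a j.succ - a (j.succ.succAbove k)))⁻¹
  have h3 : (fun t : Fin n → ℝ => residue a t j.succ) = fun t =>
      (∏ k, (a j.succ - a (j.succ.succAbove k)))⁻¹ * ∏ i, (a j.succ - t i) := by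
    ext t
    rw [residue, prod_div_distrib, div_eq_inv_mul]
  rw [h3]
  refine h2.congr_fderiv ?_
  ext v
  simp [residueJacobian, Matrix.mulVec, dotProduct, mul_sum, mul_assoc]

lemma abs_det_residueJacobian (ha : StrictAnti a) (ht : t ∈ interlacing a) :
    |(LinearMap.toContinuousLinearMap (Matrix.toLin' (residueJacobian a t))).det| =
      diffProd t / diffProd a := by
  have h1 : residueJacobian a t = Matrix.diagonal
      (fun j : Fin n => -(∏ k, (a j.succ - a (j.succ.succAbove k)))⁻¹) *
      Matrix.of fun j i => ∏ l ∈ univ.erase i, (a j.succ - t l) := by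
    ext j i
    simp [residueJacobian, Matrix.diagonal_mul]
  have hsucc : StrictAnti fun j : Fin n => a j.succ := fun i k hik => ha (by simpa using hik)
  have h2 := diffProd_pos hsucc
  have h0 : diffProd a = (∏ i : Fin n, (a 0 - a i.succ)) * diffProd fun j : Fin n => a j.succ := by
    simp [diffProd, Fin.prod_univ_succ, Fin.prod_Ioi_succ]
  have h4 : 0 < ∏ i : Fin n, (a 0 - a i.succ) :=
    prod_pos fun i _ => sub_pos.2 (ha (Fin.succ_pos i))
  have h3 : ∏ j : Fin n, ∏ k, |a j.succ - a (j.succ.succAbove k)| =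
      (∏ i : Fin n, (a 0 - a i.succ)) * (diffProd fun j : Fin n => a j.succ) ^ 2 := by
    have h := prod_erase_abs_sub a
    simp_rw [prod_erase_univ_eq_prod_succAbove] at h
    rw [Fin.prod_univ_succ] at h
    simp only [Fin.succAbove_zero] at h
    rw [← abs_prod, abs_of_pos h4, h0, mul_pow, sq (∏ i : Fin n, (a 0 - a i.succ)), mul_assoc] at h
    exact mul_left_cancel₀ h4.ne' h
  rw [ContinuousLinearMap.det, LinearMap.coe_toContinuousLinearMap, LinearMap.det_toLin', h1,
    Matrix.det_mul, abs_mul, Matrix.det_diagonal,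
    abs_det_prod_erase_sub _ _ (strictAnti_of_mem_interlacing ha ht), abs_prod]
  simp_rw [abs_neg, abs_inv, abs_prod]
  rw [prod_inv_distrib, h3, abs_of_pos h2, h0]
  field_simp

end Interlacing

section DixonAnderson

open Finset

lemma lintegral_Ioo_rpow_mul_sub_rpow {u v M : ℝ} (hu : 0 < u) (hv : 0 < v) (hM : 0 < M) :
    ∫⁻ x in Set.Ioo 0 M, ENNReal.ofReal (x ^ (u - 1) * (M - x) ^ (v - 1)) =
      ENNReal.ofReal (M ^ (u + v - 1) * (Real.Gamma u * Real.Gamma v / Real.Gamma (u + v))) := by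
  have hB := ProbabilityTheory.beta_pos hu hv
  have himage : (fun x => M * x) '' Set.Ioo 0 1 = Set.Ioo 0 M := by
    rw [Set.image_mul_left_Ioo hM]; simp
  have hderiv : ∀ x ∈ Set.Ioo (0 : ℝ) 1, HasDerivWithinAt (fun x => M * x) M (Set.Ioo 0 1) x :=
    fun x _ => by simpa using ((hasDerivAt_id x).const_mul M).hasDerivWithinAt
  rw [← himage, lintegral_image_eq_lintegral_abs_deriv_mul measurableSet_Ioo hderiv
    (mul_right_injective₀ hM.ne').injOn]
  have h1 := ProbabilityTheory.lintegral_betaPDF_eq_one hu hv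
  rw [ProbabilityTheory.lintegral_betaPDF] at h1
  have h2 : ∀ x ∈ Set.Ioo (0 : ℝ) 1, ENNReal.ofReal |M| *
      ENNReal.ofReal ((M * x) ^ (u - 1) * (M - M * x) ^ (v - 1)) =
      ENNReal.ofReal (M ^ (u + v - 1) * ProbabilityTheory.beta u v) *
      ENNReal.ofReal (1 / ProbabilityTheory.beta u v * x ^ (u - 1) * (1 - x) ^ (v - 1)) := by
    rintro x ⟨hx0, hx1⟩
    rw [← ENNReal.ofReal_mul (abs_nonneg _), ← ENNReal.ofReal_mul (by positivity), abs_of_pos hM,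
      show M - M * x = M * (1 - x) by ring, Real.mul_rpow hM.le hx0.le,
      Real.mul_rpow hM.le (sub_nonneg.2 hx1.le),
      show u + v - 1 = 1 + (u - 1) + (v - 1) by ring, Real.rpow_add hM, Real.rpow_add hM,
      Real.rpow_one]
    congr 1
    field_simp
  rw [setLIntegral_congr_fun measurableSet_Ioo h2, lintegral_const_mul' _ _ ENNReal.ofReal_ne_top,
    h1, mul_one, ProbabilityTheory.beta]

lemma measurableSet_simplex (n : ℕ) (M : ℝ) :
    MeasurableSet {w : Fin n → ℝ | (∀ j, 0 < w j) ∧ ∑ j, w j < M} := by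
  simp only [Set.ofPred_and, Set.ofPred_forall]
  exact (MeasurableSet.iInter fun j => measurableSet_lt measurable_const
    (measurable_pi_apply j)).inter (measurableSet_lt (by fun_prop) measurable_const)

/-- Dirichlet's integral. -/
lemma lintegral_simplex (n : ℕ) (s : Fin n → ℝ) (hs : ∀ j, 0 < s j) {c M : ℝ} (hc : 0 < c)
    (hM : 0 < M) :
    ∫⁻ w in {w : Fin n → ℝ | (∀ j, 0 < w j) ∧ ∑ j, w j < M},
        ENNReal.ofReal ((∏ j, w j ^ (s j - 1)) * (M - ∑ j, w j) ^ (c - 1)) =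
      ENNReal.ofReal (M ^ (∑ j, s j + c - 1) *
        ((∏ j, Real.Gamma (s j)) * Real.Gamma c / Real.Gamma (∑ j, s j + c))) := by
  induction n generalizing M with
  | zero =>
    have : {w : Fin 0 → ℝ | (∀ j, 0 < w j) ∧ ∑ j, w j < M} = Set.univ := by
      ext; simp [hM]
    rw [this, Measure.restrict_univ, lintegral_unique]
    simp [div_self (Real.Gamma_pos_of_pos hc).ne', volume_pi]
  | succ n ih =>
    have hΓ : 0 < Real.Gamma (∑ j : Fin n, s j.succ + c) :=
      Real.Gamma_pos_of_pos (add_pos_of_nonneg_of_pos (sum_nonneg fun j _ => (hs _).le) hc)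
    have hS : 0 < ∑ j : Fin n, s j.succ + c :=
      add_pos_of_nonneg_of_pos (sum_nonneg fun j _ => (hs _).le) hc
    have hinner (x : ℝ) (hx : x ∈ Set.Ioo 0 M) := ih (fun j => s j.succ) (fun j => hs _)
      (M := M - x) (sub_pos.2 hx.2)
    set f : (m : ℕ) → (Fin m → ℝ) → ℝ → (Fin m → ℝ) → ENNReal := fun m s M w =>
      ENNReal.ofReal ((∏ j, w j ^ (s j - 1)) * (M - ∑ j, w j) ^ (c - 1)) with hf
    set S : (m : ℕ) → ℝ → Set (Fin m → ℝ) := fun m M =>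
      {w | (∀ j, 0 < w j) ∧ ∑ j, w j < M} with hS'
    have hSmeas (m : ℕ) (M : ℝ) : MeasurableSet (S m M) := measurableSet_simplex m M
    have hfmeas : Measurable (f (n + 1) s M) := by
      simp only [hf]
      fun_prop
    have hpt (x : ℝ) (y : Fin n → ℝ) : (S (n + 1) M).indicator (f (n + 1) s M) (Fin.cons x y) =
        (Set.Ioo 0 M).indicator (fun x => ENNReal.ofReal (x ^ (s 0 - 1))) x *
        (S n (M - x)).indicator (f n (fun j => s j.succ) (M - x)) y := by
      have hmem : (Fin.cons x y : Fin (n + 1) → ℝ) ∈ S (n + 1) M ↔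
          x ∈ Set.Ioo 0 M ∧ y ∈ S n (M - x) := by
        simp only [hS', Set.mem_ofPred_eq, Fin.forall_fin_succ, Fin.cons_zero, Fin.cons_succ,
          Fin.sum_univ_succ, Set.mem_Ioo]
        constructor
        · rintro ⟨⟨h1, h2⟩, h3⟩
          have := sum_nonneg fun j (_ : j ∈ (univ : Finset (Fin n))) => (h2 j).le
          exact ⟨⟨h1, by linarith⟩, h2, by linarith⟩
        · rintro ⟨⟨h1, -⟩, h2, h3⟩
          exact ⟨⟨h1, h2⟩, by linarith⟩
      by_cases hx : x ∈ Set.Ioo 0 M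
      · by_cases hy : y ∈ S n (M - x)
        · rw [Set.indicator_of_mem (hmem.2 ⟨hx, hy⟩), Set.indicator_of_mem hx,
            Set.indicator_of_mem hy, ← ENNReal.ofReal_mul (Real.rpow_nonneg hx.1.le _)]
          simp only [hf, Fin.prod_univ_succ, Fin.sum_univ_succ, Fin.cons_zero, Fin.cons_succ]
          rw [mul_assoc, sub_sub]
        · rw [Set.indicator_of_notMem (fun h => hy (hmem.1 h).2), Set.indicator_of_notMem hy,
            mul_zero]
      · rw [Set.indicator_of_notMem (fun h => hx (hmem.1 h).1), Set.indicator_of_notMem hx,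
          zero_mul]
    have hmp := (volume_preserving_piFinSuccAbove (fun _ : Fin (n + 1) => ℝ) 0).symm
    have hcons (p : ℝ × (Fin n → ℝ)) :
        (MeasurableEquiv.piFinSuccAbove (fun _ : Fin (n + 1) => ℝ) 0).symm p =
          Fin.cons p.1 p.2 := by
      simp [MeasurableEquiv.piFinSuccAbove, Fin.insertNthEquiv]
    calc ∫⁻ w in S (n + 1) M, f (n + 1) s M w
        = ∫⁻ w, (S (n + 1) M).indicator (f (n + 1) s M) w := (lintegral_indicator (hSmeas _ _) _).symm
      _ = ∫⁻ p : ℝ × (Fin n → ℝ), (S (n + 1) M).indicator (f (n + 1) s M) (Fin.cons p.1 p.2) := by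
        rw [← hmp.lintegral_comp (hfmeas.indicator (hSmeas _ _))]
        simp_rw [hcons]
      _ = ∫⁻ x : ℝ, ∫⁻ y : Fin n → ℝ, (S (n + 1) M).indicator (f (n + 1) s M) (Fin.cons x y) := by
        rw [Measure.volume_eq_prod, lintegral_prod]
        have := ((hfmeas.indicator (hSmeas (n + 1) M)).comp
          (MeasurableEquiv.piFinSuccAbove (fun _ : Fin (n + 1) => ℝ) 0).symm.measurable)
        simp only [Function.comp_def, hcons] at this
        exact this.aemeasurable
      _ = ∫⁻ x : ℝ, (Set.Ioo 0 M).indicator (fun x => ENNReal.ofReal (x ^ (s 0 - 1))) x *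
          ∫⁻ y in S n (M - x), f n (fun j => s j.succ) (M - x) y := by
        refine lintegral_congr fun x => ?_
        simp_rw [hpt]
        rw [lintegral_const_mul', lintegral_indicator (hSmeas _ _)]
        by_cases hx : x ∈ Set.Ioo 0 M
        · rw [Set.indicator_of_mem hx]; exact ENNReal.ofReal_ne_top
        · rw [Set.indicator_of_notMem hx]; exact ENNReal.zero_ne_top
      _ = ∫⁻ x in Set.Ioo 0 M, ENNReal.ofReal ((∏ j : Fin n, Real.Gamma (s j.succ)) * Real.Gamma c /
            Real.Gamma (∑ j : Fin n, s j.succ + c)) * ENNReal.ofReal (x ^ (s 0 - 1) *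
            (M - x) ^ ((∑ j : Fin n, s j.succ + c) - 1)) := by
        rw [← lintegral_indicator measurableSet_Ioo]
        refine lintegral_congr fun x => ?_
        by_cases hx : x ∈ Set.Ioo 0 M
        · have h0 := Real.rpow_nonneg hx.1.le (s 0 - 1)
          have h1 : 0 ≤ (∏ j : Fin n, Real.Gamma (s j.succ)) * Real.Gamma c /
              Real.Gamma (∑ j : Fin n, s j.succ + c) :=
            div_nonneg (mul_nonneg (prod_nonneg fun j _ => (Real.Gamma_pos_of_pos (hs _)).le)
              (Real.Gamma_pos_of_pos hc).le) hΓ.le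
          rw [Set.indicator_of_mem hx, Set.indicator_of_mem hx, hinner x hx,
            ← ENNReal.ofReal_mul h0, ← ENNReal.ofReal_mul h1]
          congr 1
          ring
        · rw [Set.indicator_of_notMem hx, Set.indicator_of_notMem hx, zero_mul]
      _ = _ := by
        rw [lintegral_const_mul' _ _ ENNReal.ofReal_ne_top,
          lintegral_Ioo_rpow_mul_sub_rpow (hs 0) hS hM, ← ENNReal.ofReal_mul]
        · rw [Fin.sum_univ_succ, Fin.prod_univ_succ, add_assoc]
          congr 1
          field_simp
        · exact div_nonneg (mul_nonneg (prod_nonneg fun j _ => (Real.Gamma_pos_of_pos (hs _)).le)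
              (Real.Gamma_pos_of_pos hc).le) hΓ.le

/-- The Dixon–Anderson integral. -/
lemma lintegral_interlacing {n : ℕ} {a : Fin (n + 1) → ℝ} (ha : StrictAnti a)
    {s : Fin (n + 1) → ℝ} (hs : ∀ j, 0 < s j) :
    ∫⁻ t in interlacing a, ENNReal.ofReal (diffProd t * ∏ j, ∏ i, |a j - t i| ^ (s j - 1)) =
      ENNReal.ofReal (diffProd a * (∏ j, ∏ i, |a j - a (j.succAbove i)| ^ (s j - 1)) *
        ((∏ j, Real.Gamma (s j)) / Real.Gamma (∑ j, s j))) := by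
  have hda := diffProd_pos ha
  have hA : 0 ≤ diffProd a * ∏ j, ∏ i, |a j - a (j.succAbove i)| ^ (s j - 1) :=
    mul_nonneg hda.le (prod_nonneg fun j _ => prod_nonneg fun i _ =>
      Real.rpow_nonneg (abs_nonneg _) _)
  have h1 := lintegral_simplex n (fun j => s j.succ) (fun j => hs _) (hs 0) one_pos
  rw [← image_residue_succ ha, lintegral_image_eq_lintegral_abs_det_fderiv_mul volume
    measurableSet_interlacing (fun t _ => (hasFDerivAt_residue_succ a t).hasFDerivWithinAt)
    (injOn_residue_succ ha), Real.one_rpow, one_mul] at h1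
  have h2 : (∏ j, Real.Gamma (s j)) / Real.Gamma (∑ j, s j) =
      (∏ j : Fin n, Real.Gamma (s j.succ)) * Real.Gamma (s 0) /
        Real.Gamma (∑ j : Fin n, s j.succ + s 0) := by
    rw [Fin.prod_univ_succ, Fin.sum_univ_succ, mul_comm, add_comm (s 0)]
  rw [h2, ENNReal.ofReal_mul hA, ← h1, ← lintegral_const_mul' _ _ ENNReal.ofReal_ne_top]
  refine setLIntegral_congr_fun measurableSet_interlacing fun t ht => ?_
  have hdt := diffProd_pos (strictAnti_of_mem_interlacing ha ht)
  have hne (j : Fin (n + 1)) (i : Fin n) : 0 < |a j - a (j.succAbove i)| :=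
    abs_pos.2 (sub_ne_zero.2 fun h => (Fin.succAbove_ne j i) (ha.injective h).symm)
  have hres (j : Fin (n + 1)) : residue a t j ^ (s j - 1) =
      (∏ i, |a j - t i| ^ (s j - 1)) / ∏ i, |a j - a (j.succAbove i)| ^ (s j - 1) := by
    rw [← abs_of_pos (residue_pos ha ht j), residue, abs_prod,
      ← Real.finsetProd_rpow _ _ fun i _ => abs_nonneg _, ← prod_div_distrib]
    exact prod_congr rfl fun i _ => by rw [abs_div, Real.div_rpow (abs_nonneg _) (abs_nonneg _)]
  have h0 : 1 - ∑ j : Fin n, residue a t j.succ = residue a t 0 := by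
    have := sum_residue ha t
    rw [Fin.sum_univ_succ] at this
    linarith
  have h3 : (∏ j : Fin n, residue a t j.succ ^ (s j.succ - 1)) * residue a t 0 ^ (s 0 - 1) =
      (∏ j, ∏ i, |a j - t i| ^ (s j - 1)) /
        ∏ j, ∏ i, |a j - a (j.succAbove i)| ^ (s j - 1) := by
    rw [mul_comm, ← Fin.prod_univ_succ (fun j => residue a t j ^ (s j - 1)), ← prod_div_distrib]
    exact prod_congr rfl fun j _ => hres j
  have hpos : 0 < ∏ j, ∏ i, |a j - a (j.succAbove i)| ^ (s j - 1) :=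
    prod_pos fun j _ => prod_pos fun i _ => Real.rpow_pos_of_pos (hne j i) _
  dsimp only
  rw [abs_det_residueJacobian ha ht, h0, h3, ← ENNReal.ofReal_mul (by positivity),
    ← ENNReal.ofReal_mul hA]
  congr 1
  field_simp

end DixonAnderson

section Selberg

open Finset

/-- Strictly decreasing sequences in the open unit interval. -/
def decreasingCube (n : ℕ) : Set (Fin n → ℝ) :=
  {t | (∀ j k : Fin n, j < k → t k < t j) ∧ (∀ j, 0 < t j) ∧ ∀ j, t j < 1}

lemma mem_decreasingCube {n : ℕ} {t : Fin n → ℝ} :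
    t ∈ decreasingCube n ↔ StrictAnti t ∧ (∀ j, 0 < t j) ∧ ∀ j, t j < 1 :=
  Iff.rfl

lemma measurableSet_decreasingCube (n : ℕ) : MeasurableSet (decreasingCube n) := by
  simp only [decreasingCube, Set.ofPred_and, Set.ofPred_forall]
  exact (MeasurableSet.iInter fun j => MeasurableSet.iInter fun k => MeasurableSet.iInter fun _ =>
    measurableSet_lt (measurable_pi_apply k) (measurable_pi_apply j)).inter
    ((MeasurableSet.iInter fun j => measurableSet_lt measurable_const (measurable_pi_apply j)).inter
    (MeasurableSet.iInter fun j => measurableSet_lt (measurable_pi_apply j) measurable_const))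

@[fun_prop]
lemma measurable_diffProd (n : ℕ) : Measurable (diffProd (n := n)) := by
  unfold diffProd
  fun_prop

lemma diffProd_le_one {n : ℕ} {t : Fin n → ℝ} (ht : t ∈ decreasingCube n) : diffProd t ≤ 1 := by
  obtain ⟨h1, h2, h3⟩ := ht
  refine prod_le_one (fun i _ => prod_nonneg fun j hj => ?_)
    fun i _ => prod_le_one (fun j hj => ?_) fun j _ => ?_
  · exact (sub_pos.2 (h1 i j (mem_Ioi.1 hj))).le
  · exact (sub_pos.2 (h1 i j (mem_Ioi.1 hj))).le
  · linarith [h2 j, h3 i]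

/-- The sequence `x` with `1` prepended and `0` appended. -/
def cap {n : ℕ} (x : Fin n → ℝ) : Fin (n + 2) → ℝ :=
  Fin.cons 1 (Fin.snoc (α := fun _ => ℝ) x 0)

section cap

variable {n : ℕ} (x : Fin n → ℝ)

@[simp] lemma cap_zero : cap x 0 = 1 := rfl

lemma cap_succ_last : cap x (Fin.last n).succ = 0 := by
  simp [cap, -Fin.succ_last]

@[simp] lemma cap_last : cap x (Fin.last (n + 1)) = 0 :=
  cap_succ_last x

@[simp] lemma cap_succ_castSucc (i : Fin n) : cap x i.castSucc.succ = x i := by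
  simp [cap]

lemma strictAnti_cap {x : Fin n → ℝ} (hx : x ∈ decreasingCube n) : StrictAnti (cap x) := by
  obtain ⟨h1, h2, h3⟩ := hx
  intro i j hij
  induction i using Fin.cases with
  | zero =>
    induction j using Fin.cases with
    | zero => exact absurd hij (lt_irrefl _)
    | succ j =>
      induction j using Fin.lastCases with
      | last => simp
      | cast j => simpa using h3 j
  | succ i =>
    induction j using Fin.cases with
    | zero => exact absurd hij (Fin.not_lt_zero _)
    | succ j =>
      induction i using Fin.lastCases with
      | last =>
        rw [Fin.succ_lt_succ_iff] at hij
        exact absurd hij (not_lt_of_ge (Fin.le_last _))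
      | cast i =>
        induction j using Fin.lastCases with
        | last => simpa using h2 i
        | cast j => simpa using h1 i j (by simpa using hij)

/-- Interlacing as a symmetric relation between sequences of length `n + 1` and `n`. -/
lemma mem_decreasingCube_and_mem_interlacing {x : Fin n → ℝ} {t : Fin (n + 1) → ℝ} :
    t ∈ decreasingCube (n + 1) ∧ x ∈ interlacing t ↔
      x ∈ decreasingCube n ∧ t ∈ interlacing (cap x) := by
  constructor
  · rintro ⟨⟨h1, h2, h3⟩, hx⟩
    have hxt := mem_interlacing.1 hx
    refine ⟨⟨strictAnti_of_mem_interlacing h1 hx, fun j => (h2 _).trans (hxt j).1,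
      fun j => (hxt j).2.trans (h3 _)⟩, mem_interlacing.2 fun i => ⟨?_, ?_⟩⟩
    · induction i using Fin.lastCases with
      | last => simpa using h2 _
      | cast i => simpa using (hxt i).2
    · induction i using Fin.cases with
      | zero => simpa using h3 _
      | succ i => simpa [Fin.castSucc_succ] using (hxt i).1
  · rintro ⟨hx, ht⟩
    have hc := strictAnti_cap hx
    have htx := mem_interlacing.1 ht
    refine ⟨⟨strictAnti_of_mem_interlacing hc ht, fun j => ?_, fun j => ?_⟩,
      mem_interlacing.2 fun i => ⟨?_, ?_⟩⟩
    · have := hc.antitone (Fin.succ_le_succ_iff.2 (Fin.le_last j))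
      rw [cap_succ_last] at this
      exact this.trans_lt (htx j).1
    · have := hc.antitone (Fin.zero_le j.castSucc)
      rw [cap_zero] at this
      exact (htx j).2.trans_le this
    · simpa [Fin.castSucc_succ] using (htx i.succ).2
    · simpa using (htx i.castSucc).1

end cap

lemma diffProd_eq_prod_ite {n : ℕ} (t : Fin n → ℝ) :
    diffProd t = ∏ i, ∏ j, if i < j then t i - t j else 1 := by
  simp_rw [diffProd, ← prod_filter, filter_lt_eq_Ioi]

lemma prod_succAbove_eq_prod_ite {n : ℕ} (j : Fin (n + 1)) (f : Fin (n + 1) → ℝ) :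
    ∏ i, f (j.succAbove i) = ∏ k, if k = j then 1 else f k := by
  rw [← prod_erase_univ_eq_prod_succAbove, ← filter_ne' univ j, prod_filter]
  exact prod_congr rfl fun k _ => by simp [ite_not]

lemma prod_ite_abs_sub_rpow {n : ℕ} {t : Fin n → ℝ} (ht : 0 < diffProd t) (c : ℝ) :
    ∏ i, ∏ j, (if j = i then 1 else |t i - t j| ^ c) = diffProd t ^ (2 * c) := by
  have h : ∏ i, ∏ j ∈ univ.erase i, |t i - t j| ^ c = diffProd t ^ (2 * c) := by
    rw [Real.rpow_mul ht.le, Real.rpow_two, ← prod_erase_abs_sub,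
      ← Real.finsetProd_rpow _ _ fun i _ => prod_nonneg fun j _ => abs_nonneg _]
    exact prod_congr rfl fun i _ => Real.finsetProd_rpow _ _ (fun j _ => abs_nonneg _) _
  rw [← h]
  refine prod_congr rfl fun i _ => ?_
  rw [← filter_ne' univ i, prod_filter]
  exact prod_congr rfl fun k _ => by simp [ite_not]

lemma diffProd_cap {n : ℕ} (x : Fin n → ℝ) :
    diffProd (cap x) = (∏ i, (1 - x i) * x i) * diffProd x := by
  rw [diffProd_eq_prod_ite, diffProd_eq_prod_ite, Fin.prod_univ_succ]
  simp only [Fin.prod_univ_succ (n := n + 1), Fin.prod_univ_castSucc (n := n), cap_zero,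
    cap_succ_last, cap_succ_castSucc, Fin.succ_lt_succ_iff, Fin.castSucc_lt_castSucc_iff,
    prod_mul_distrib]
  simp [Fin.castSucc_lt_last, (Fin.castSucc_lt_last _).not_gt]
  ring

/-- The exponents used at the points of `cap x`. -/
def capExponent (n : ℕ) (α β γ : ℝ) : Fin (n + 2) → ℝ :=
  Fin.cons β (Fin.snoc (α := fun _ => ℝ) (fun _ : Fin n => γ) α)

section capExponent

variable {n : ℕ} (α β γ : ℝ)

@[simp] lemma capExponent_zero : capExponent n α β γ 0 = β := rfl

lemma capExponent_succ_last : capExponent n α β γ (Fin.last n).succ = α := by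
  simp [capExponent, -Fin.succ_last]

@[simp] lemma capExponent_succ_castSucc (i : Fin n) :
    capExponent n α β γ i.castSucc.succ = γ := by
  simp [capExponent]

lemma prod_cap_sub_rpow (x : Fin n → ℝ) (t : Fin (n + 1) → ℝ) (ht0 : ∀ i, 0 < t i)
    (ht1 : ∀ i, t i < 1) :
    ∏ j, ∏ i, |cap x j - t i| ^ (capExponent n α β γ j - 1) =
      (∏ i, t i ^ (α - 1) * (1 - t i) ^ (β - 1)) * ∏ j, ∏ i, |t j - x i| ^ (γ - 1) := by
  rw [prod_comm (s := univ) (t := univ) (f := fun j i => |t j - x i| ^ (γ - 1)),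
    Fin.prod_univ_succ, Fin.prod_univ_castSucc
      (fun j => ∏ i, |cap x j.succ - t i| ^ (capExponent n α β γ j.succ - 1))]
  simp only [cap_zero, cap_succ_last, cap_succ_castSucc, capExponent_zero, capExponent_succ_last,
    capExponent_succ_castSucc, prod_mul_distrib, zero_sub, abs_neg]
  have h1 (i : Fin (n + 1)) : |1 - t i| = 1 - t i := abs_of_pos (sub_pos.2 (ht1 i))
  have h2 (i : Fin (n + 1)) : |t i| = t i := abs_of_pos (ht0 i)
  simp_rw [h1, h2, abs_sub_comm]
  ring

lemma prod_cap_succAbove_rpow {x : Fin n → ℝ} (hx : x ∈ decreasingCube n) :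
    ∏ j, ∏ i, |cap x j - cap x (j.succAbove i)| ^ (capExponent n α β γ j - 1) =
      (∏ i, x i ^ (α - 1 + (γ - 1)) * (1 - x i) ^ (β - 1 + (γ - 1))) *
        diffProd x ^ (2 * (γ - 1)) := by
  obtain ⟨hx1, hx2, hx3⟩ := hx
  have h1 (i : Fin n) : |1 - x i| = 1 - x i := abs_of_pos (sub_pos.2 (hx3 i))
  have h2 (i : Fin n) : |x i| = x i := abs_of_pos (hx2 i)
  have h3 (j : Fin (n + 2)) := prod_succAbove_eq_prod_ite j
    fun k => |cap x j - cap x k| ^ (capExponent n α β γ j - 1)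
  simp_rw [h3]
  rw [← prod_ite_abs_sub_rpow (diffProd_pos hx1)]
  simp only [Fin.prod_univ_succ (n := n + 1), Fin.prod_univ_castSucc (n := n), cap_zero,
    cap_succ_last, cap_succ_castSucc, capExponent_zero, capExponent_succ_last,
    capExponent_succ_castSucc, prod_mul_distrib, zero_sub, abs_neg, Fin.succ_inj,
    Fin.castSucc_inj, sub_zero]
  simp only [Fin.succ_ne_zero, (Fin.succ_ne_zero _).symm, Fin.castSucc_ne_last,
    (Fin.castSucc_ne_last _).symm, if_true, if_false, abs_one, Real.one_rpow, mul_one, one_mul,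
    abs_sub_comm _ (1 : ℝ), h1, h2]
  rw [← prod_mul_distrib, ← prod_mul_distrib]
  simp_rw [fun i => Real.rpow_add (hx2 i), fun i => Real.rpow_add (sub_pos.2 (hx3 i)),
    prod_mul_distrib]
  ring

end capExponent

lemma setLIntegral_setLIntegral_swap {X Y : Type*} [MeasurableSpace X] [MeasurableSpace Y]
    {μ : Measure X} {ν : Measure Y} [SFinite μ] [SFinite ν] {S : Set X} {T : Set Y}
    {A : X → Set Y} {B : Y → Set X} (hST : ∀ x y, x ∈ S ∧ y ∈ A x ↔ y ∈ T ∧ x ∈ B y)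
    (hS : MeasurableSet S) (hT : MeasurableSet T) (hA : ∀ x, MeasurableSet (A x))
    (hB : ∀ y, MeasurableSet (B y)) (hR : MeasurableSet {p : X × Y | p.1 ∈ S ∧ p.2 ∈ A p.1})
    {F : X → Y → ENNReal} (hF : Measurable fun p : X × Y => F p.1 p.2) :
    ∫⁻ x in S, ∫⁻ y in A x, F x y ∂ν ∂μ = ∫⁻ y in T, ∫⁻ x in B y, F x y ∂μ ∂ν := by
  set R : Set (X × Y) := {p | p.1 ∈ S ∧ p.2 ∈ A p.1} with hRdef
  have key := lintegral_lintegral_swap (μ := μ) (ν := ν)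
    (f := fun x y => R.indicator (fun p => F p.1 p.2) (x, y)) (hF.indicator hR).aemeasurable
  have h1 (x : X) : ∫⁻ y, R.indicator (fun p => F p.1 p.2) (x, y) ∂ν =
      S.indicator (fun x => ∫⁻ y in A x, F x y ∂ν) x := by
    by_cases hx : x ∈ S
    · rw [Set.indicator_of_mem hx, ← lintegral_indicator (hA x)]
      refine lintegral_congr fun y => ?_
      by_cases hy : y ∈ A x
      · rw [Set.indicator_of_mem hy, Set.indicator_of_mem (show (x, y) ∈ R from ⟨hx, hy⟩)]
      · rw [Set.indicator_of_notMem hy, Set.indicator_of_notMem (fun h : (x, y) ∈ R => hy h.2)]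
    · rw [Set.indicator_of_notMem hx]
      refine (lintegral_congr fun y => ?_).trans lintegral_zero
      exact Set.indicator_of_notMem (fun h : (x, y) ∈ R => hx h.1) _
  have h2 (y : Y) : ∫⁻ x, R.indicator (fun p => F p.1 p.2) (x, y) ∂μ =
      T.indicator (fun y => ∫⁻ x in B y, F x y ∂μ) y := by
    by_cases hy : y ∈ T
    · rw [Set.indicator_of_mem hy, ← lintegral_indicator (hB y)]
      refine lintegral_congr fun x => ?_
      by_cases hx : x ∈ B y
      · rw [Set.indicator_of_mem hx,
          Set.indicator_of_mem (show (x, y) ∈ R from (hST x y).2 ⟨hy, hx⟩)]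
      · rw [Set.indicator_of_notMem hx,
          Set.indicator_of_notMem (fun h : (x, y) ∈ R => hx ((hST x y).1 h).2)]
    · rw [Set.indicator_of_notMem hy]
      refine (lintegral_congr fun x => ?_).trans lintegral_zero
      exact Set.indicator_of_notMem (fun h : (x, y) ∈ R => hy ((hST x y).1 h).1) _
  simp_rw [h1, h2] at key
  rwa [lintegral_indicator hS, lintegral_indicator hT] at key

/-- The Selberg integral over strictly decreasing sequences. -/
noncomputable def selbergLIntegral (n : ℕ) (α β γ : ℝ) : ENNReal :=
  ∫⁻ t in decreasingCube n, ENNReal.ofReal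
    ((∏ i, t i ^ (α - 1) * (1 - t i) ^ (β - 1)) * diffProd t ^ (2 * γ))

lemma lintegral_interlacing_const {n : ℕ} {t : Fin (n + 1) → ℝ} (ht : StrictAnti t) {γ : ℝ}
    (hγ : 0 < γ) :
    ∫⁻ x in interlacing t, ENNReal.ofReal (diffProd x * ∏ j, ∏ i, |t j - x i| ^ (γ - 1)) =
      ENNReal.ofReal (diffProd t ^ (2 * γ - 1) *
        (Real.Gamma γ ^ (n + 1) / Real.Gamma ((n + 1) * γ))) := by
  have hpos := diffProd_pos ht
  rw [lintegral_interlacing ht (s := fun _ => γ) fun _ => hγ]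
  have h (j : Fin (n + 1)) := prod_succAbove_eq_prod_ite j fun k => |t j - t k| ^ (γ - 1)
  simp_rw [h]
  rw [prod_ite_abs_sub_rpow hpos, show 2 * γ - 1 = 1 + 2 * (γ - 1) by ring, Real.rpow_add hpos,
    Real.rpow_one]
  simp

lemma lintegral_interlacing_cap {n : ℕ} {x : Fin n → ℝ} (hx : x ∈ decreasingCube n)
    {α β γ : ℝ} (hα : 0 < α) (hβ : 0 < β) (hγ : 0 < γ) :
    ∫⁻ t in interlacing (cap x), ENNReal.ofReal (diffProd t *
        ((∏ i, t i ^ (α - 1) * (1 - t i) ^ (β - 1)) * ∏ j, ∏ i, |t j - x i| ^ (γ - 1))) =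
      ENNReal.ofReal ((∏ i, x i ^ (α + γ - 1) * (1 - x i) ^ (β + γ - 1)) *
        diffProd x ^ (2 * γ - 1) *
        (Real.Gamma α * Real.Gamma β * Real.Gamma γ ^ n / Real.Gamma (α + β + n * γ))) := by
  have hpos := diffProd_pos hx.1
  have hs (j : Fin (n + 2)) : 0 < capExponent n α β γ j := by
    induction j using Fin.cases with
    | zero => exact hβ
    | succ j =>
      induction j using Fin.lastCases with
      | last => rwa [capExponent_succ_last]
      | cast j => rwa [capExponent_succ_castSucc]
  have h1 := lintegral_interlacing (strictAnti_cap hx) hs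
  have h2 : ∀ t ∈ interlacing (cap x), ENNReal.ofReal (diffProd t *
      ∏ j, ∏ i, |cap x j - t i| ^ (capExponent n α β γ j - 1)) = ENNReal.ofReal (diffProd t *
        ((∏ i, t i ^ (α - 1) * (1 - t i) ^ (β - 1)) * ∏ j, ∏ i, |t j - x i| ^ (γ - 1))) := by
    intro t ht
    obtain ⟨⟨-, ht0, ht1⟩, -⟩ := mem_decreasingCube_and_mem_interlacing.2 ⟨hx, ht⟩
    rw [prod_cap_sub_rpow α β γ x t ht0 ht1]
  rw [setLIntegral_congr_fun measurableSet_interlacing h2] at h1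
  rw [h1, prod_cap_succAbove_rpow α β γ hx, diffProd_cap]
  have hprod : ∏ j, Real.Gamma (capExponent n α β γ j) =
      Real.Gamma α * Real.Gamma β * Real.Gamma γ ^ n := by
    rw [Fin.prod_univ_succ, Fin.prod_univ_castSucc]
    simp only [capExponent_zero, capExponent_succ_last, capExponent_succ_castSucc, prod_const,
      card_univ, Fintype.card_fin]
    ring
  have hsum : ∑ j, capExponent n α β γ j = α + β + n * γ := by
    rw [Fin.sum_univ_succ, Fin.sum_univ_castSucc]
    simp only [capExponent_zero, capExponent_succ_last, capExponent_succ_castSucc, sum_const,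
      card_univ, Fintype.card_fin, nsmul_eq_mul]
    ring
  have hx' (i : Fin n) : x i ^ (α + γ - 1) * (1 - x i) ^ (β + γ - 1) = (1 - x i) * x i *
      (x i ^ (α - 1 + (γ - 1)) * (1 - x i) ^ (β - 1 + (γ - 1))) := by
    rw [show α + γ - 1 = 1 + (α - 1 + (γ - 1)) by ring,
      show β + γ - 1 = 1 + (β - 1 + (γ - 1)) by ring, Real.rpow_add (hx.2.1 i),
      Real.rpow_add (sub_pos.2 (hx.2.2 i)), Real.rpow_one, Real.rpow_one]
    ring
  rw [hprod, hsum, show 2 * γ - 1 = 1 + 2 * (γ - 1) by ring, Real.rpow_add hpos, Real.rpow_one]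
  simp_rw [hx']
  rw [prod_mul_distrib (f := fun i => (1 - x i) * x i)]
  congr 1
  ring

lemma selbergLIntegral_succ (n : ℕ) {α β γ : ℝ} (hα : 0 < α) (hβ : 0 < β) (hγ : 0 < γ) :
    selbergLIntegral (n + 1) α β γ *
        ENNReal.ofReal (Real.Gamma γ ^ (n + 1) / Real.Gamma ((n + 1) * γ)) =
      selbergLIntegral n (α + γ) (β + γ) γ * ENNReal.ofReal
        (Real.Gamma α * Real.Gamma β * Real.Gamma γ ^ n / Real.Gamma (α + β + n * γ)) := by
  set F : (Fin (n + 1) → ℝ) → (Fin n → ℝ) → ENNReal := fun t x => ENNReal.ofReal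
    (diffProd x * diffProd t * ((∏ i, t i ^ (α - 1) * (1 - t i) ^ (β - 1)) *
      ∏ j, ∏ i, |t j - x i| ^ (γ - 1))) with hFdef
  have hF : Measurable fun p : (Fin (n + 1) → ℝ) × (Fin n → ℝ) => F p.1 p.2 := by
    simp only [hFdef]
    fun_prop
  have hR : MeasurableSet {p : (Fin (n + 1) → ℝ) × (Fin n → ℝ) |
      p.1 ∈ decreasingCube (n + 1) ∧ p.2 ∈ interlacing p.1} := by
    simp only [mem_interlacing, Set.ofPred_and, Set.ofPred_forall]
    refine (measurable_fst (measurableSet_decreasingCube _)).inter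
      (MeasurableSet.iInter fun i => MeasurableSet.inter ?_ ?_)
    · exact measurableSet_lt (by fun_prop) (by fun_prop)
    · exact measurableSet_lt (by fun_prop) (by fun_prop)
  have hswap := setLIntegral_setLIntegral_swap (μ := volume) (ν := volume)
    (fun t x => mem_decreasingCube_and_mem_interlacing (x := x) (t := t))
    (measurableSet_decreasingCube _) (measurableSet_decreasingCube _)
    (fun _ => measurableSet_interlacing) (fun _ => measurableSet_interlacing) hR hF
  rw [selbergLIntegral, selbergLIntegral, ← lintegral_mul_const' _ _ ENNReal.ofReal_ne_top,
    ← lintegral_mul_const' _ _ ENNReal.ofReal_ne_top]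
  convert hswap using 1
  · refine setLIntegral_congr_fun (measurableSet_decreasingCube _) fun t ht => ?_
    have hpos := diffProd_pos ht.1
    have hw : 0 ≤ ∏ i, t i ^ (α - 1) * (1 - t i) ^ (β - 1) := prod_nonneg fun i _ =>
      mul_nonneg (Real.rpow_nonneg (ht.2.1 i).le _)
        (Real.rpow_nonneg (sub_pos.2 (ht.2.2 i)).le _)
    have hfac (x : Fin n → ℝ) : F t x =
        ENNReal.ofReal (diffProd t * ∏ i, t i ^ (α - 1) * (1 - t i) ^ (β - 1)) *
          ENNReal.ofReal (diffProd x * ∏ j, ∏ i, |t j - x i| ^ (γ - 1)) := by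
      rw [← ENNReal.ofReal_mul (mul_nonneg hpos.le hw)]
      simp only [hFdef]
      congr 1
      ring
    simp_rw [hfac]
    rw [lintegral_const_mul' _ _ ENNReal.ofReal_ne_top, lintegral_interlacing_const ht.1 hγ,
      ← ENNReal.ofReal_mul (mul_nonneg hpos.le hw),
      ← ENNReal.ofReal_mul (mul_nonneg hw (Real.rpow_nonneg hpos.le _)),
      show 2 * γ = 1 + (2 * γ - 1) by ring, Real.rpow_add hpos, Real.rpow_one]
    congr 1
    ring_nf
  · refine setLIntegral_congr_fun (measurableSet_decreasingCube _) fun x hx => ?_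
    have hpos := diffProd_pos hx.1
    have hw : 0 ≤ ∏ i, x i ^ (α + γ - 1) * (1 - x i) ^ (β + γ - 1) := prod_nonneg fun i _ =>
      mul_nonneg (Real.rpow_nonneg (hx.2.1 i).le _)
        (Real.rpow_nonneg (sub_pos.2 (hx.2.2 i)).le _)
    have hfac (t : Fin (n + 1) → ℝ) : F t x = ENNReal.ofReal (diffProd x) *
        ENNReal.ofReal (diffProd t * ((∏ i, t i ^ (α - 1) * (1 - t i) ^ (β - 1)) *
          ∏ j, ∏ i, |t j - x i| ^ (γ - 1))) := by
      rw [← ENNReal.ofReal_mul hpos.le]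
      simp only [hFdef]
      congr 1
      ring
    simp_rw [hfac]
    rw [lintegral_const_mul' _ _ ENNReal.ofReal_ne_top, lintegral_interlacing_cap hx hα hβ hγ,
      ← ENNReal.ofReal_mul hpos.le,
      ← ENNReal.ofReal_mul (mul_nonneg hw (Real.rpow_nonneg hpos.le _)),
      show 2 * γ = 1 + (2 * γ - 1) by ring, Real.rpow_add hpos, Real.rpow_one]
    congr 1
    ring_nf

/-- The value of the Selberg integral over strictly decreasing sequences. -/
noncomputable def selbergValue (n : ℕ) (α β γ : ℝ) : ℝ :=
  1 / n.factorial * ∏ j ∈ range n, Real.Gamma (α + j * γ) * Real.Gamma (β + j * γ) *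
    Real.Gamma ((j + 1) * γ + 1) / (Real.Gamma (α + β + (n + j - 1) * γ) * Real.Gamma (γ + 1))

lemma add_nat_add_nat_sub_one_mul_pos {n j : ℕ} (hj : j < n) {x γ : ℝ} (hx : 0 < x)
    (hγ : 0 ≤ γ) : 0 < x + (n + j - 1) * γ := by
  have h1 : (1 : ℝ) ≤ n := by exact_mod_cast Nat.one_le_of_lt hj
  have h2 : (0 : ℝ) ≤ n + j - 1 := by linarith [j.cast_nonneg (α := ℝ)]
  positivity

lemma selbergValue_nonneg (n : ℕ) {α β γ : ℝ} (hα : 0 < α) (hβ : 0 < β) (hγ : 0 ≤ γ) :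
    0 ≤ selbergValue n α β γ := by
  refine mul_nonneg (by positivity) (prod_nonneg fun j hj => ?_)
  have h := add_nat_add_nat_sub_one_mul_pos (mem_range.1 hj) (add_pos hα hβ) hγ
  have h1 := Real.Gamma_pos_of_pos h
  have h2 := Real.Gamma_pos_of_pos (show 0 < α + j * γ by positivity)
  have h3 := Real.Gamma_pos_of_pos (show 0 < β + j * γ by positivity)
  have h4 := Real.Gamma_pos_of_pos (show 0 < (j + 1) * γ + 1 by positivity)
  have h5 := Real.Gamma_pos_of_pos (show 0 < γ + 1 by positivity)
  positivity

lemma selbergValue_succ (n : ℕ) {α β γ : ℝ} (hα : 0 < α) (hβ : 0 < β) (hγ : 0 < γ) :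
    selbergValue (n + 1) α β γ * (Real.Gamma γ ^ (n + 1) / Real.Gamma ((n + 1) * γ)) =
      selbergValue n (α + γ) (β + γ) γ *
        (Real.Gamma α * Real.Gamma β * Real.Gamma γ ^ n / Real.Gamma (α + β + n * γ)) := by
  have hA : ∏ j ∈ range (n + 1), Real.Gamma (α + j * γ) =
      (∏ j ∈ range n, Real.Gamma (α + γ + j * γ)) * Real.Gamma α := by
    rw [prod_range_succ']
    push_cast
    rw [zero_mul, add_zero]
    congr 1
    exact prod_congr rfl fun j _ => by ring_nf
  have hB : ∏ j ∈ range (n + 1), Real.Gamma (β + j * γ) =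
      (∏ j ∈ range n, Real.Gamma (β + γ + j * γ)) * Real.Gamma β := by
    rw [prod_range_succ']
    push_cast
    rw [zero_mul, add_zero]
    congr 1
    exact prod_congr rfl fun j _ => by ring_nf
  have hD : ∏ j ∈ range (n + 1), Real.Gamma (α + β + ((n + 1 : ℕ) + j - 1) * γ) =
      (∏ j ∈ range n, Real.Gamma (α + γ + (β + γ) + (n + j - 1) * γ)) *
        Real.Gamma (α + β + n * γ) := by
    rw [prod_range_succ']
    push_cast
    congr 1
    · exact prod_congr rfl fun j _ => by ring_nf
    · ring_nf
  have hD0 : ∏ j ∈ range n, Real.Gamma (α + γ + (β + γ) + (n + j - 1) * γ) ≠ 0 :=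
    prod_ne_zero_iff.2 fun j hj => (Real.Gamma_pos_of_pos (add_nat_add_nat_sub_one_mul_pos
      (mem_range.1 hj) (by positivity) hγ.le)).ne'
  have h1 := (Real.Gamma_pos_of_pos hγ).ne'
  have h2 := (Real.Gamma_pos_of_pos (show 0 < α + β + n * γ by positivity)).ne'
  have h3 := (Real.Gamma_pos_of_pos (show 0 < (n + 1) * γ by positivity)).ne'
  have h4 : (n.factorial : ℝ) ≠ 0 := by positivity
  have h5 : (n + 1 : ℝ) ≠ 0 := by positivity
  simp only [selbergValue, prod_div_distrib, prod_mul_distrib, prod_const, card_range]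
  rw [hA, hB, hD, prod_range_succ, Real.Gamma_add_one (show ((n + 1) * γ : ℝ) ≠ 0 by positivity),
    Real.Gamma_add_one hγ.ne', Nat.factorial_succ]
  push_cast
  field_simp
  ring

lemma selbergLIntegral_eq_of_pos (n : ℕ) {α β γ : ℝ} (hα : 0 < α) (hβ : 0 < β) (hγ : 0 < γ) :
    selbergLIntegral n α β γ = ENNReal.ofReal (selbergValue n α β γ) := by
  induction n generalizing α β with
  | zero =>
    have : decreasingCube 0 = Set.univ := by
      ext; simp [decreasingCube]
    rw [selbergLIntegral, this, Measure.restrict_univ, lintegral_unique]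
    simp [selbergValue, diffProd, volume_pi]
  | succ n ih =>
    have h1 := Real.Gamma_pos_of_pos hγ
    have h3 := Real.Gamma_pos_of_pos (show 0 < (n + 1) * γ by positivity)
    have hc : 0 < Real.Gamma γ ^ (n + 1) / Real.Gamma ((n + 1) * γ) := by positivity
    have h := selbergLIntegral_succ n hα hβ hγ
    rw [ih (add_pos hα hγ) (add_pos hβ hγ), ← ENNReal.ofReal_mul
      (selbergValue_nonneg n (add_pos hα hγ) (add_pos hβ hγ) hγ.le), ← selbergValue_succ n hα hβ hγ,
      ENNReal.ofReal_mul (selbergValue_nonneg _ hα hβ hγ.le)] at h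
    exact (ENNReal.mul_left_inj (ENNReal.ofReal_pos.2 hc).ne' ENNReal.ofReal_ne_top).1 h

open Filter Topology in
/-- **Selberg's integral formula**. -/
lemma selbergLIntegral_eq (n : ℕ) {α β γ : ℝ} (hα : 0 < α) (hβ : 0 < β) (hγ : 0 ≤ γ) :
    selbergLIntegral n α β γ = ENNReal.ofReal (selbergValue n α β γ) := by
  rcases hγ.lt_or_eq with hγ | rfl
  · exact selbergLIntegral_eq_of_pos n hα hβ hγ
  have hlim : Tendsto (fun k : ℕ => 1 / ((k : ℝ) + 1)) atTop (𝓝 0) :=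
    tendsto_one_div_add_atTop_nhds_zero_nat
  have hleft : Tendsto (fun k : ℕ => selbergLIntegral n α β (1 / ((k : ℝ) + 1))) atTop
      (𝓝 (selbergLIntegral n α β 0)) := by
    refine lintegral_tendsto_of_tendsto_of_monotone (fun k => ?_) ?_ ?_
    · fun_prop
    · refine ae_restrict_of_forall_mem (measurableSet_decreasingCube n) fun t ht => ?_
      have hw : 0 ≤ ∏ i, t i ^ (α - 1) * (1 - t i) ^ (β - 1) := prod_nonneg fun i _ =>
        mul_nonneg (Real.rpow_nonneg (ht.2.1 i).le _)
          (Real.rpow_nonneg (sub_pos.2 (ht.2.2 i)).le _)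
      intro k l hkl
      refine ENNReal.ofReal_le_ofReal (mul_le_mul_of_nonneg_left ?_ hw)
      refine Real.rpow_le_rpow_of_exponent_ge (diffProd_pos ht.1) (diffProd_le_one ht) ?_
      exact mul_le_mul_of_nonneg_left (Nat.one_div_le_one_div hkl) zero_le_two
    · refine ae_restrict_of_forall_mem (measurableSet_decreasingCube n) fun t ht => ?_
      refine ENNReal.tendsto_ofReal (Tendsto.const_mul _ ?_)
      exact tendsto_const_nhds.rpow (hlim.const_mul 2) (Or.inl (diffProd_pos ht.1).ne')
  have hcont : ContinuousAt (fun γ => selbergValue n α β γ) 0 := by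
    have hΓ {f : ℝ → ℝ} (hf : Continuous f) (h0 : 0 < f 0) :
        ContinuousAt (fun γ => Real.Gamma (f γ)) 0 := by
      refine ContinuousAt.comp (f := f) (g := Real.Gamma) ?_ hf.continuousAt
      refine (Real.differentiableAt_Gamma fun m => ?_).continuousAt
      have : (0 : ℝ) ≤ m := m.cast_nonneg
      linarith
    unfold selbergValue
    refine continuousAt_const.mul (tendsto_finsetProd _ fun j _ => ?_)
    refine ContinuousAt.div ?_ ?_ ?_
    · refine ((hΓ (by fun_prop) ?_).mul (hΓ (by fun_prop) ?_)).mul (hΓ (by fun_prop) ?_) <;>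
        simp [hα, hβ]
    · refine (hΓ (by fun_prop) ?_).mul (hΓ (by fun_prop) ?_)
      · simpa using add_pos hα hβ
      · simp
    · have := (Real.Gamma_pos_of_pos (add_pos hα hβ)).ne'
      simpa
  refine tendsto_nhds_unique hleft ?_
  simp_rw [fun k : ℕ => selbergLIntegral_eq_of_pos n hα hβ
    (show 0 < 1 / ((k : ℝ) + 1) by positivity)]
  exact ENNReal.tendsto_ofReal (hcont.tendsto.comp hlim)

end Selberg

section Squares

open Finset

variable {n : ℕ}

lemma injOn_sq_decreasingCube :
    Set.InjOn (fun (x : Fin n → ℝ) i => x i ^ 2) (decreasingCube n) := by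
  intro x hx y hy h
  ext i
  exact (pow_left_inj₀ (hx.2.1 i).le (hy.2.1 i).le two_ne_zero).1 (congr_fun h i)

lemma sq_mem_decreasingCube {x : Fin n → ℝ} (hx : x ∈ decreasingCube n) :
    (fun i => x i ^ 2) ∈ decreasingCube n := by
  obtain ⟨h1, h2, h3⟩ := hx
  exact ⟨fun j k hjk => pow_lt_pow_left₀ (h1 j k hjk) (h2 k).le two_ne_zero,
    fun j => pow_pos (h2 j) 2, fun j => pow_lt_one₀ (h2 j).le (h3 j) two_ne_zero⟩

lemma image_sq_decreasingCube :
    (fun (x : Fin n → ℝ) i => x i ^ 2) '' decreasingCube n = decreasingCube n := by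
  refine Set.Subset.antisymm (Set.image_subset_iff.2 fun x hx => sq_mem_decreasingCube hx) ?_
  rintro t ⟨h1, h2, h3⟩
  refine ⟨fun i => √(t i), ⟨fun j k hjk => Real.sqrt_lt_sqrt (h2 k).le (h1 j k hjk),
    fun j => Real.sqrt_pos.2 (h2 j), fun j => ?_⟩, funext fun i => Real.sq_sqrt (h2 i).le⟩
  rw [Real.sqrt_lt' one_pos, one_pow]
  exact h3 j

lemma hasFDerivAt_pi_sq (x : Fin n → ℝ) :
    HasFDerivAt (fun (x : Fin n → ℝ) i => x i ^ 2)
      (LinearMap.toContinuousLinearMap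
        (Matrix.toLin' (Matrix.diagonal fun i => 2 * x i))) x := by
  rw [hasFDerivAt_pi']
  intro j
  refine ((hasFDerivAt_apply (𝕜 := ℝ) j x).pow 2).congr_fderiv ?_
  ext v
  simp [Matrix.mulVec_diagonal]

/-- The part of the integrand which does not depend on the exponent `s`. -/
noncomputable def squareWeight (a b : ℝ) (x : Fin n → ℝ) : ℝ :=
  (∏ j, x j ^ (2 * b + 1)) * diffProd (fun j => x j ^ 2) ^ a

lemma squareWeight_nonneg {x : Fin n → ℝ} (hx : x ∈ decreasingCube n) (a b : ℝ) :
    0 ≤ squareWeight a b x :=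
  mul_nonneg (prod_nonneg fun j _ => Real.rpow_nonneg (hx.2.1 j).le _)
    (Real.rpow_nonneg (diffProd_pos (mem_decreasingCube.1 (sq_mem_decreasingCube hx)).1).le _)

lemma measurable_squareWeight (a b : ℝ) : Measurable (squareWeight (n := n) a b) := by
  unfold squareWeight
  fun_prop

lemma lintegral_squareWeight {a b σ : ℝ} (ha : 0 ≤ a) (hb : 0 ≤ b) (hσ : -1 < σ) :
    ∫⁻ x in decreasingCube n, ENNReal.ofReal ((∏ j, (1 - x j ^ 2) ^ σ) * squareWeight a b x) =
      ENNReal.ofReal (selbergValue n (b + 1) (σ + 1) (a / 2) / 2 ^ n) := by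
  have h := selbergLIntegral_eq n (α := b + 1) (β := σ + 1) (γ := a / 2) (by linarith)
    (by linarith) (by linarith)
  rw [selbergLIntegral] at h
  nth_rw 1 [← image_sq_decreasingCube] at h
  rw [lintegral_image_eq_lintegral_abs_det_fderiv_mul volume (measurableSet_decreasingCube n)
    (fun x _ => (hasFDerivAt_pi_sq x).hasFDerivWithinAt) injOn_sq_decreasingCube] at h
  have h2 : (0 : ℝ) < 2 ^ n := by positivity
  rw [ENNReal.ofReal_div_of_pos h2, ← h,
    ENNReal.eq_div_iff (by simp) ENNReal.ofReal_ne_top,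
    ← lintegral_const_mul' _ _ ENNReal.ofReal_ne_top]
  refine setLIntegral_congr_fun (measurableSet_decreasingCube n) fun x hx => ?_
  have hpos := hx.2.1
  rw [ContinuousLinearMap.det, LinearMap.coe_toContinuousLinearMap, LinearMap.det_toLin',
    Matrix.det_diagonal, ← ENNReal.ofReal_mul h2.le, ← ENNReal.ofReal_mul (abs_nonneg _)]
  congr 1
  rw [abs_of_pos (prod_pos fun j _ => mul_pos two_pos (hpos j)), prod_mul_distrib, prod_const,
    card_univ, Fintype.card_fin, squareWeight, mul_div_cancel₀ a two_ne_zero, mul_assoc,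
    ← mul_assoc (∏ j, (1 - x j ^ 2) ^ σ), ← mul_assoc (∏ j, x j), ← prod_mul_distrib,
    ← prod_mul_distrib]
  congr 2
  refine prod_congr rfl fun j _ => ?_
  rw [add_sub_cancel_right, add_sub_cancel_right, Real.rpow_add_one (hpos j).ne',
    ← Real.rpow_natCast_mul (hpos j).le]
  push_cast
  ring

/-- The measure with density `squareWeight a b` on the decreasing cube. -/
noncomputable def squareMeasure (n : ℕ) (a b : ℝ) : Measure (Fin n → ℝ) :=
  (volume.restrict (decreasingCube n)).withDensity fun x => ENNReal.ofReal (squareWeight a b x)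

/-- The logarithm of `∏ j, (1 - x j ^ 2)`. -/
noncomputable def logOneSubSq (x : Fin n → ℝ) : ℝ :=
  ∑ j, Real.log (1 - x j ^ 2)

@[fun_prop]
lemma measurable_logOneSubSq : Measurable (logOneSubSq (n := n)) := by
  unfold logOneSubSq
  fun_prop

lemma one_sub_sq_pos {x : Fin n → ℝ} (hx : x ∈ decreasingCube n) (j : Fin n) :
    0 < 1 - x j ^ 2 :=
  sub_pos.2 ((sq_mem_decreasingCube hx).2.2 j)

lemma exp_mul_logOneSubSq {x : Fin n → ℝ} (hx : x ∈ decreasingCube n) (σ : ℝ) :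
    Real.exp (σ * logOneSubSq x) = ∏ j, (1 - x j ^ 2) ^ σ := by
  rw [logOneSubSq, mul_sum, Real.exp_sum]
  exact prod_congr rfl fun j _ => by rw [Real.rpow_def_of_pos (one_sub_sq_pos hx j), mul_comm]

lemma cexp_mul_logOneSubSq {x : Fin n → ℝ} (hx : x ∈ decreasingCube n) (s : ℂ) :
    Complex.exp (s * logOneSubSq x) = ∏ j, (1 - (x j : ℂ) ^ 2) ^ s := by
  rw [logOneSubSq, ofReal_sum, mul_sum, Complex.exp_sum]
  refine prod_congr rfl fun j _ => ?_
  have h := one_sub_sq_pos hx j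
  have h' : (1 - (x j : ℂ) ^ 2) = ((1 - x j ^ 2 : ℝ) : ℂ) := by push_cast; rfl
  rw [h', Complex.cpow_def_of_ne_zero (ofReal_ne_zero.2 h.ne'), ofReal_log h.le, mul_comm]

lemma lintegral_exp_mul_logOneSubSq {a b σ : ℝ} (ha : 0 ≤ a) (hb : 0 ≤ b) (hσ : -1 < σ) :
    ∫⁻ x, ENNReal.ofReal (Real.exp (σ * logOneSubSq x)) ∂squareMeasure n a b =
      ENNReal.ofReal (selbergValue n (b + 1) (σ + 1) (a / 2) / 2 ^ n) := by
  rw [← lintegral_squareWeight ha hb hσ, squareMeasure,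
    lintegral_withDensity_eq_lintegral_mul _ (measurable_squareWeight a b).ennreal_ofReal
      (by fun_prop)]
  refine setLIntegral_congr_fun (measurableSet_decreasingCube n) fun x hx => ?_
  rw [Pi.mul_apply, ← ENNReal.ofReal_mul (squareWeight_nonneg hx a b), mul_comm,
    exp_mul_logOneSubSq hx]

lemma Ioi_subset_integrableExpSet {a b : ℝ} (ha : 0 ≤ a) (hb : 0 ≤ b) :
    Set.Ioi (-1) ⊆ ProbabilityTheory.integrableExpSet logOneSubSq (squareMeasure n a b) := by
  intro σ hσ
  refine ⟨by fun_prop, ?_⟩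
  rw [hasFiniteIntegral_iff_ofReal (.of_forall fun _ => (Real.exp_pos _).le),
    lintegral_exp_mul_logOneSubSq ha hb hσ]
  exact ENNReal.ofReal_lt_top

lemma mgf_logOneSubSq {a b σ : ℝ} (ha : 0 ≤ a) (hb : 0 ≤ b) (hσ : -1 < σ) :
    ProbabilityTheory.mgf logOneSubSq (squareMeasure n a b) σ =
      selbergValue n (b + 1) (σ + 1) (a / 2) / 2 ^ n := by
  rw [ProbabilityTheory.mgf, integral_eq_lintegral_of_nonneg_ae
    (.of_forall fun _ => (Real.exp_pos _).le) (by fun_prop),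
    lintegral_exp_mul_logOneSubSq ha hb hσ, ENNReal.toReal_ofReal]
  exact div_nonneg (selbergValue_nonneg n (by linarith) (by linarith) (by linarith))
    (by positivity)

lemma complexMGF_logOneSubSq (a b : ℝ) (s : ℂ) :
    ProbabilityTheory.complexMGF logOneSubSq (squareMeasure n a b) s =
      ∫ x in decreasingCube n, (∏ j, ((1 - (x j : ℂ) ^ 2) ^ s * ((x j ^ (2 * b + 1) : ℝ) : ℂ))) *
        ∏ j, ∏ l ∈ Ioi j, (((x j ^ 2 - x l ^ 2) ^ a : ℝ) : ℂ) := by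
  rw [ProbabilityTheory.complexMGF, squareMeasure, integral_withDensity_eq_integral_toReal_smul
    (measurable_squareWeight a b).ennreal_ofReal (.of_forall fun _ => ENNReal.ofReal_lt_top)]
  refine setIntegral_congr_fun (measurableSet_decreasingCube n) fun x hx => ?_
  have hsub (j : Fin n) (l : Fin n) (hl : l ∈ Ioi j) : 0 ≤ x j ^ 2 - x l ^ 2 :=
    (sub_pos.2 ((sq_mem_decreasingCube hx).1 j l (mem_Ioi.1 hl))).le
  have hdiff : diffProd (fun j => x j ^ 2) ^ a = ∏ j, ∏ l ∈ Ioi j, (x j ^ 2 - x l ^ 2) ^ a := by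
    rw [diffProd, ← Real.finsetProd_rpow _ _ fun j _ => prod_nonneg (hsub j)]
    exact prod_congr rfl fun j _ => (Real.finsetProd_rpow _ _ (hsub j) _).symm
  rw [ENNReal.toReal_ofReal (squareWeight_nonneg hx a b), cexp_mul_logOneSubSq hx, squareWeight,
    hdiff, prod_mul_distrib, real_smul]
  push_cast
  ring

/-- The product of Gamma factors in the complex variable `s`. -/
noncomputable def complexSelbergValue (n : ℕ) (a b : ℝ) (s : ℂ) : ℂ :=
  (1 / (2 ^ n * (n.factorial : ℂ))) *
    ∏ j : Fin n, Complex.Gamma ((b : ℂ) + 1 + (j : ℂ) * ((a : ℂ) / 2)) *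
      Complex.Gamma (s + 1 + (j : ℂ) * ((a : ℂ) / 2)) *
      Complex.Gamma (((j : ℂ) + 1) * ((a : ℂ) / 2) + 1) /
      (Complex.Gamma (s + (b : ℂ) + 2 + ((n : ℂ) + (j : ℂ) - 1) * ((a : ℂ) / 2)) *
        Complex.Gamma ((a : ℂ) / 2 + 1))

lemma complexSelbergValue_ofReal (a b σ : ℝ) :
    complexSelbergValue n a b σ =
      ((selbergValue n (b + 1) (σ + 1) (a / 2) / 2 ^ n : ℝ) : ℂ) := by
  rw [complexSelbergValue, selbergValue, prod_range]
  push_cast [← Complex.Gamma_ofReal]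
  rw [show ((b : ℂ) + 1 + (σ + 1)) = σ + b + 2 by ring, one_div_mul_eq_div, one_div_mul_eq_div,
    div_div, mul_comm (2 ^ n : ℂ)]

lemma differentiableOn_complexSelbergValue {a b : ℝ} (ha : 0 ≤ a) (hb : 0 ≤ b) :
    DifferentiableOn ℂ (complexSelbergValue n a b) {s | -1 < s.re} := by
  intro s hs
  have hs' : -1 < s.re := hs
  refine DifferentiableAt.differentiableWithinAt ?_
  unfold complexSelbergValue
  refine DifferentiableAt.const_mul (DifferentiableAt.fun_finsetProd fun j _ => ?_) _
  have hj : (1 : ℝ) ≤ n := by exact_mod_cast j.pos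
  have h1 : 0 < (s + 1 + (j : ℂ) * ((a : ℂ) / 2)).re := by
    rw [show (s + 1 + (j : ℂ) * ((a : ℂ) / 2)) = s + ((1 + j * (a / 2) : ℝ) : ℂ) by push_cast; ring,
      add_re, ofReal_re]
    have : 0 ≤ (j : ℝ) * (a / 2) := by positivity
    linarith
  have h2 : 0 < (s + (b : ℂ) + 2 + ((n : ℂ) + (j : ℂ) - 1) * ((a : ℂ) / 2)).re := by
    rw [show (s + (b : ℂ) + 2 + ((n : ℂ) + (j : ℂ) - 1) * ((a : ℂ) / 2)) =
      s + ((b + 2 + (n + j - 1) * (a / 2) : ℝ) : ℂ) by push_cast; ring, add_re, ofReal_re]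
    have : 0 ≤ ((n : ℝ) + j - 1) * (a / 2) :=
      mul_nonneg (by linarith [(j : ℕ).cast_nonneg (α := ℝ)]) (by linarith)
    linarith
  have h3 : 0 < ((a : ℂ) / 2 + 1).re := by
    rw [show ((a : ℂ) / 2 + 1) = ((a / 2 + 1 : ℝ) : ℂ) by push_cast; ring, ofReal_re]
    linarith
  have hd {z : ℂ} (hz : 0 < z.re) : DifferentiableAt ℂ Complex.Gamma z :=
    Complex.differentiableAt_Gamma _ fun m hm => by
      rw [hm, neg_re, natCast_re] at hz
      linarith [m.cast_nonneg (α := ℝ)]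
  refine DifferentiableAt.div ?_ ?_ (mul_ne_zero (Complex.Gamma_ne_zero_of_re_pos h2)
    (Complex.Gamma_ne_zero_of_re_pos h3))
  · refine DifferentiableAt.mul_const (DifferentiableAt.const_mul ?_ _) _
    exact (hd h1).comp s (f := fun s : ℂ => s + 1 + (j : ℂ) * ((a : ℂ) / 2)) (by fun_prop)
  · refine DifferentiableAt.mul_const ?_ _
    exact (hd h2).comp s
      (f := fun s : ℂ => s + (b : ℂ) + 2 + ((n : ℂ) + (j : ℂ) - 1) * ((a : ℂ) / 2)) (by fun_prop)

lemma complexMGF_eq_complexSelbergValue {a b : ℝ} (ha : 0 ≤ a) (hb : 0 ≤ b) {s : ℂ}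
    (hs : -1 < s.re) :
    ProbabilityTheory.complexMGF logOneSubSq (squareMeasure n a b) s =
      complexSelbergValue n a b s := by
  have hU : IsOpen {s : ℂ | -1 < s.re} := isOpen_lt continuous_const continuous_re
  have hsub : {s : ℂ | -1 < s.re} ⊆ {s | s.re ∈
      interior (ProbabilityTheory.integrableExpSet logOneSubSq (squareMeasure n a b))} :=
    fun z hz => interior_maximal (Ioi_subset_integrableExpSet ha hb) isOpen_Ioi hz
  refine (ProbabilityTheory.analyticOnNhd_complexMGF.mono hsub).eqOn_of_preconnected_of_frequently_eq
    ((differentiableOn_complexSelbergValue ha hb).analyticOnNhd hU)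
    (convex_halfSpace_re_gt (-1)).isPreconnected (z₀ := 0) (by simp) ?_ hs
  have hlim : Filter.Tendsto (fun k : ℕ => ((1 / ((k : ℝ) + 1) : ℝ) : ℂ)) Filter.atTop
      (nhdsWithin 0 {0}ᶜ) := by
    refine tendsto_nhdsWithin_iff.2 ⟨?_, .of_forall fun k => ?_⟩
    · exact (continuous_ofReal.tendsto' 0 0 ofReal_zero).comp tendsto_one_div_add_atTop_nhds_zero_nat
    · exact ofReal_ne_zero.2 (by positivity)
  refine hlim.frequently (.of_forall fun k => ?_)
  have hk : (-1 : ℝ) < 1 / ((k : ℝ) + 1) := neg_one_lt_zero.trans (by positivity)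
  rw [ProbabilityTheory.complexMGF_ofReal, mgf_logOneSubSq ha hb hk, complexSelbergValue_ofReal]

end Squares

/-- The integral `F(s) = ∫_{1>λ₁>⋯>λ_r>0} ∏ (1-λ_j²)^s λ_j^{2b+1} ∏_{j<k} (λ_j²-λ_k²)^a dλ`
equals `(1/(2^r r!)) ∏_{j=1}^r Γ(b+1+(j-1)a/2)Γ(s+1+(j-1)a/2)Γ(ja/2+1) /
(Γ(s+b+2+(r+j-2)a/2)Γ(a/2+1))` for `Re s > -1`.
Here the index `j : Fin r` corresponds to `j+1` in the classical notation. -/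
theorem selberg_type_integral_F (r : ℕ) (hr : 0 < r) (a b : ℝ) (ha : 0 ≤ a) (hb : 0 ≤ b)
    (s : ℂ) (hs : -1 < s.re) :
    ∫ lam : Fin r → ℝ in
        {lam : Fin r → ℝ | (∀ j k : Fin r, j < k → lam k < lam j) ∧
          (∀ j, 0 < lam j) ∧ (∀ j, lam j < 1)},
        (∏ j : Fin r,
            ((1 - ((lam j : ℂ)) ^ 2) ^ s * (((lam j ^ (2 * b + 1) : ℝ)) : ℂ))) *
          ∏ j : Fin r, ∏ l ∈ Finset.Ioi j, ((((lam j ^ 2 - lam l ^ 2) ^ a : ℝ)) : ℂ)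
      = (1 / (2 ^ r * (r.factorial : ℂ))) *
          ∏ j : Fin r,
            Complex.Gamma ((b : ℂ) + 1 + (j : ℂ) * ((a : ℂ) / 2)) *
                Complex.Gamma (s + 1 + (j : ℂ) * ((a : ℂ) / 2)) *
                Complex.Gamma (((j : ℂ) + 1) * ((a : ℂ) / 2) + 1) /
              (Complex.Gamma (s + (b : ℂ) + 2 + ((r : ℂ) + (j : ℂ) - 1) * ((a : ℂ) / 2)) *
                Complex.Gamma ((a : ℂ) / 2 + 1)) := by
  exact (complexMGF_logOneSubSq a b s).symm.trans (complexMGF_eq_complexSelbergValue ha hb hs)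
end
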